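/- For every k ≥ 1 and every deterministic k-head tree-walking automaton with nested pebbles, there exists an equivalent deterministic k-head tree-walking automaton with nested pebbles (accepting the same tree language) that halts on every input tree. -/

import Mathlib

namespace NestedPebbles

/-- Trees over a ranked alphabet `(Sig, rank)`: terms `σ(t₁,…,tₙ)` with `rank σ = n`. -/
inductive RTree (Sig : Type) (rank : Sig → ℕ) : Type
  | node (a : Sig) (children : Fin (rank a) → RTree Sig rank) : RTree Sig rank

namespace RTree

variable {Sig : Type} {rank : Sig → ℕ}

/-- The label of the root symbol. -/
def label : RTree Sig rank → Sig
  | node a _ => a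

/-- The `i`-th (0-based) immediate subtree, if it exists. -/
def child : RTree Sig rank → ℕ → Option (RTree Sig rank)
  | node a c, i => if h : i < rank a then some (c ⟨i, h⟩) else none

/-- The subtree at a position (a list of 0-based child indices, read from the root). -/
def subtree : RTree Sig rank → List ℕ → Option (RTree Sig rank)
  | t, [] => some t
  | t, i :: p => (t.child i).bind fun s => s.subtree p

end RTree

variable {Sig : Type} {rank : Sig → ℕ}

/-- `p` is (the address of) a node of `t`. -/
def IsPos (t : RTree Sig rank) (p : List ℕ) : Prop := (t.subtree p).isSome = true

/-- The type of nodes of a tree `t`, as valid positions. -/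
def Pos (t : RTree Sig rank) : Type := { p : List ℕ // IsPos t p }

/-- The root node. -/
def rootPos (t : RTree Sig rank) : Pos t := ⟨[], rfl⟩

/-- The label of the node of `t` at position `p`. -/
def labelAt (t : RTree Sig rank) (p : List ℕ) : Option Sig := (t.subtree p).map RTree.label

/-- The child number of a node: `0` for the root, and `j` for a `j`-th child (1-based). -/
def childNo (p : List ℕ) : ℕ :=
  match p.getLast? with
  | none => 0
  | some j => j + 1

/-!  ### First-order logic with k-ary transitive closure, on trees  -/

/-- First-order formulas over a ranked alphabet, with a `k`-ary transitive closure
operator.  Variables are natural numbers.  `lab a x` means `x` has label `a`;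
`edg i x y` means `y` is the `i`-th child of `x` (`i` is 1-based);
`le x y` means `x` is an ancestor of `y`; `tc xs ys φ us vs` is the transitive
closure `φ*` of `φ` with respect to the tuples of variables `xs`, `ys` (which it
binds), applied to the tuples of variables `us`, `vs`. -/
inductive TForm (Sig : Type) (rank : Sig → ℕ) (k : ℕ) : Type
  | lab (a : Sig) (x : ℕ)
  | edg (i : ℕ) (x y : ℕ)
  | le (x y : ℕ)
  | eq (x y : ℕ)
  | not (φ : TForm Sig rank k)
  | and (φ ψ : TForm Sig rank k)
  | or (φ ψ : TForm Sig rank k)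
  | ex (x : ℕ) (φ : TForm Sig rank k)
  | all (x : ℕ) (φ : TForm Sig rank k)
  | tc (xs ys : Fin k → ℕ) (φ : TForm Sig rank k) (us vs : Fin k → ℕ)

/-- Update a valuation on a tuple of variables simultaneously. -/
noncomputable def updVec {α : Type} {k : ℕ} (ν : ℕ → α) (xs : Fin k → ℕ) (a : Fin k → α) :
    ℕ → α :=
  fun n => if h : ∃ i, xs i = n then a h.choose else ν n

/-- Satisfaction of a formula in a tree `t` under a valuation of the variables by
nodes of `t`. -/
def Sat {k : ℕ} (t : RTree Sig rank) : TForm Sig rank k → (ℕ → Pos t) → Prop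
  | .lab a x, ν => labelAt t (ν x).1 = some a
  | .edg i x y, ν => 1 ≤ i ∧ (ν y).1 = (ν x).1 ++ [i - 1]
  | .le x y, ν => (ν x).1 <+: (ν y).1
  | .eq x y, ν => ν x = ν y
  | .not φ, ν => ¬ Sat t φ ν
  | .and φ ψ, ν => Sat t φ ν ∧ Sat t ψ ν
  | .or φ ψ, ν => Sat t φ ν ∨ Sat t ψ ν
  | .ex x φ, ν => ∃ u : Pos t, Sat t φ (Function.update ν x u)
  | .all x φ, ν => ∀ u : Pos t, Sat t φ (Function.update ν x u)
  | .tc xs ys φ us vs, ν =>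
      Relation.ReflTransGen
        (fun a b : Fin k → Pos t => Sat t φ (updVec (updVec ν xs a) ys b))
        (fun i => ν (us i)) (fun i => ν (vs i))

/-- The free variables of a formula. -/
def freeVars {k : ℕ} : TForm Sig rank k → Set ℕ
  | .lab _ x => {x}
  | .edg _ x y => {x, y}
  | .le x y => {x, y}
  | .eq x y => {x, y}
  | .not φ => freeVars φ
  | .and φ ψ => freeVars φ ∪ freeVars ψ
  | .or φ ψ => freeVars φ ∪ freeVars ψ
  | .ex x φ => freeVars φ \ {x}
  | .all x φ => freeVars φ \ {x}
  | .tc xs ys φ us vs =>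
      (freeVars φ \ (Set.range xs ∪ Set.range ys)) ∪ Set.range us ∪ Set.range vs

/-- Two `k`-tuples of variables consist of `2k` pairwise distinct variables. -/
def Distinct2 {k : ℕ} (xs ys : Fin k → ℕ) : Prop :=
  Function.Injective xs ∧ Function.Injective ys ∧ ∀ i j, xs i ≠ ys j

/-- `φ` is functional in the tuples of variables `xs`, `ys`: for every tree, every
valuation of the remaining variables, and every value of `xs`, there is at most one
value of `ys` satisfying `φ`. -/
def FunctionalIn {k : ℕ} (φ : TForm Sig rank k) (xs ys : Fin k → ℕ) : Prop :=
  ∀ (t : RTree Sig rank) (ν : ℕ → Pos t) (a b b' : Fin k → Pos t),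
    Sat t φ (updVec (updVec ν xs a) ys b) →
    Sat t φ (updVec (updVec ν xs a) ys b') → b = b'

/-- Well-formedness: in each transitive closure the `2k` bound variables are
pairwise distinct and occur free in the body. -/
def WF {k : ℕ} : TForm Sig rank k → Prop
  | .not φ => WF φ
  | .and φ ψ => WF φ ∧ WF ψ
  | .or φ ψ => WF φ ∧ WF ψ
  | .ex _ φ => WF φ
  | .all _ φ => WF φ
  | .tc xs ys φ _ _ =>
      Distinct2 xs ys ∧ (Set.range xs ∪ Set.range ys) ⊆ freeVars φ ∧ WF φ
  | _ => True

/-- All transitive closures occurring in the formula are deterministic, i.e., applied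
to functional formulas. -/
def DetTC {k : ℕ} : TForm Sig rank k → Prop
  | .not φ => DetTC φ
  | .and φ ψ => DetTC φ ∧ DetTC ψ
  | .or φ ψ => DetTC φ ∧ DetTC ψ
  | .ex _ φ => DetTC φ
  | .all _ φ => DetTC φ
  | .tc xs ys φ _ _ => FunctionalIn φ xs ys ∧ DetTC φ
  | _ => True

/-- All occurrences of transitive closure are positive (within the scope of an even
number of negations); the polarity parameter `b` is `true` for an even number. -/
def PosTC {k : ℕ} : Bool → TForm Sig rank k → Prop
  | b, .not φ => PosTC (!b) φ
  | b, .and φ ψ => PosTC b φ ∧ PosTC b ψ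
  | b, .or φ ψ => PosTC b φ ∧ PosTC b ψ
  | b, .ex _ φ => PosTC b φ
  | b, .all _ φ => PosTC b φ
  | b, .tc _ _ φ _ _ => b = true ∧ PosTC b φ
  | _, _ => True

/-- The formula contains no transitive closure operator (pure first-order). -/
def TCFree {k : ℕ} : TForm Sig rank k → Prop
  | .not φ => TCFree φ
  | .and φ ψ => TCFree φ ∧ TCFree ψ
  | .or φ ψ => TCFree φ ∧ TCFree ψ
  | .ex _ φ => TCFree φ
  | .all _ φ => TCFree φ
  | .tc _ _ _ _ _ => False
  | _ => True

/-- The tree language defined by a (closed) formula. -/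
def treesOf {k : ℕ} (φ : TForm Sig rank k) : Set (RTree Sig rank) :=
  {t | Sat t φ fun _ => rootPos t}

/-- `FO+DTC^k`: tree languages definable by closed first-order formulas with `k`-ary
deterministic transitive closure. -/
def FODTC (Sig : Type) (rank : Sig → ℕ) (k : ℕ) : Set (Set (RTree Sig rank)) :=
  {L | ∃ φ : TForm Sig rank k, WF φ ∧ DetTC φ ∧ freeVars φ = ∅ ∧ L = treesOf φ}

/-- `FO+TC^k`: tree languages definable by closed first-order formulas with `k`-ary
transitive closure. -/
def FOTC (Sig : Type) (rank : Sig → ℕ) (k : ℕ) : Set (Set (RTree Sig rank)) :=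
  {L | ∃ φ : TForm Sig rank k, WF φ ∧ freeVars φ = ∅ ∧ L = treesOf φ}

/-- `FO+posTC^k`: tree languages definable by closed first-order formulas in which
every occurrence of the `k`-ary transitive closure operator is positive. -/
def FOposTC (Sig : Type) (rank : Sig → ℕ) (k : ℕ) : Set (Set (RTree Sig rank)) :=
  {L | ∃ φ : TForm Sig rank k, WF φ ∧ PosTC true φ ∧ freeVars φ = ∅ ∧ L = treesOf φ}

/-!  ### k-head tree-walking automata with nested pebbles  -/

/-- Tests of a `k`-head tree-walking automaton with pebble set `X`:
label of the node under head `i`, presence of pebble `x` at head `i`, and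
child number of the node under head `i`. -/
inductive TTest (Sig : Type) (k : ℕ) (X : Type) : Type
  | lab (i : Fin k) (a : Sig)
  | peb (i : Fin k) (x : X)
  | chno (i : Fin k) (j : ℕ)

/-- Instructions: move head `i` up / down to the `j`-th child (1-based), drop a
pebble at head `i`, retrieve the most recently dropped pebble (from a distance),
or perform a positive (`b = true`) or negated (`b = false`) test. -/
inductive TInstr (Sig : Type) (k : ℕ) (X : Type) : Type
  | up (i : Fin k)
  | down (i : Fin k) (j : ℕ)
  | dropPeb (i : Fin k) (x : X)
  | retrieve (x : X)
  | test (b : Bool) (τ : TTest Sig k X)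

/-- A `k`-head tree-walking automaton with nested pebbles: a finite state set `Q`,
a finite pebble set `X`, an initial state, accepting states, and a finite set of
instructions `⟨p, χ, q⟩`. -/
structure TWA (Sig : Type) (rank : Sig → ℕ) (k : ℕ) : Type 1 where
  Q : Type
  finQ : Fintype Q
  X : Type
  finX : Fintype X
  q0 : Q
  acc : Set Q
  instr : Set (Q × TInstr Sig k X × Q)
  instrFin : instr.Finite

/-- Configurations: a state, the positions of the `k` heads, and the stack of
dropped pebbles with their positions (most recent first). -/
abbrev TConf {Sig : Type} {rank : Sig → ℕ} {k : ℕ} (A : TWA Sig rank k)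
    (t : RTree Sig rank) : Type :=
  A.Q × (Fin k → Pos t) × List (A.X × Pos t)

/-- Semantics of tests. -/
def testHolds {k : ℕ} (t : RTree Sig rank) {X : Type} (τ : TTest Sig k X)
    (hs : Fin k → Pos t) (π : List (X × Pos t)) : Prop :=
  match τ with
  | .lab i a => labelAt t (hs i).1 = some a
  | .peb i x => (x, hs i) ∈ π
  | .chno i j => childNo (hs i).1 = j

/-- Semantics of a single instruction, relating head positions and pebble stacks
before and after. -/
def instrStep {k : ℕ} (t : RTree Sig rank) {X : Type} (ins : TInstr Sig k X)
    (hs : Fin k → Pos t) (π : List (X × Pos t))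
    (hs' : Fin k → Pos t) (π' : List (X × Pos t)) : Prop :=
  match ins with
  | .up i => π' = π ∧ (∃ j : ℕ, (hs i).1 = (hs' i).1 ++ [j]) ∧ ∀ h, h ≠ i → hs' h = hs h
  | .down i j => π' = π ∧ 1 ≤ j ∧ (hs' i).1 = (hs i).1 ++ [j - 1] ∧ ∀ h, h ≠ i → hs' h = hs h
  | .dropPeb i x => hs' = hs ∧ π' = (x, hs i) :: π ∧ ∀ w, (x, w) ∉ π
  | .retrieve x => hs' = hs ∧ ∃ w, π = (x, w) :: π'
  | .test b τ => hs' = hs ∧ π' = π ∧ (testHolds t τ hs π ↔ b = true)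

/-- The step relation of automaton `A` on tree `t`. -/
def Step {k : ℕ} (A : TWA Sig rank k) (t : RTree Sig rank) :
    TConf A t → TConf A t → Prop :=
  fun c c' => ∃ ins : TInstr Sig k A.X,
    (c.1, ins, c'.1) ∈ A.instr ∧ instrStep t ins c.2.1 c.2.2 c'.2.1 c'.2.2

/-- `χ'` is the negation of the test `χ`. -/
def negOf {k : ℕ} {X : Type} (χ χ' : TInstr Sig k X) : Prop :=
  ∃ b τ, χ = TInstr.test b τ ∧ χ' = TInstr.test (!b) τ

/-- Determinism: any two distinct instructions with the same source state consist
of a test and its negation. -/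
def Deterministic {k : ℕ} (A : TWA Sig rank k) : Prop :=
  ∀ p χ₁ q₁ χ₂ q₂, (p, χ₁, q₁) ∈ A.instr → (p, χ₂, q₂) ∈ A.instr →
    (χ₁, q₁) ≠ (χ₂, q₂) → negOf χ₁ χ₂ ∨ negOf χ₂ χ₁

/-- The initial configuration: initial state, all heads at the root, no pebbles. -/
def initConf {k : ℕ} (A : TWA Sig rank k) (t : RTree Sig rank) : TConf A t :=
  (A.q0, fun _ => rootPos t, [])

/-- A configuration is halting if no step is possible from it. -/
def HaltingConf {k : ℕ} (A : TWA Sig rank k) (t : RTree Sig rank) (c : TConf A t) : Prop :=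
  ∀ c', ¬ Step A t c c'

/-- Acceptance: some computation from the initial configuration halts in an
accepting state with all heads at the root and no pebbles on the tree. -/
def Accepts {k : ℕ} (A : TWA Sig rank k) (t : RTree Sig rank) : Prop :=
  ∃ q ∈ A.acc,
    Relation.ReflTransGen (Step A t) (initConf A t) (q, fun _ => rootPos t, []) ∧
    HaltingConf A t (q, fun _ => rootPos t, [])

/-- The tree language accepted by `A`. -/
def Lang {k : ℕ} (A : TWA Sig rank k) : Set (RTree Sig rank) := {t | Accepts A t}

/-- The automaton uses no pebbles at all. -/
def PebbleFree {k : ℕ} (A : TWA Sig rank k) : Prop :=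
  ∀ p χ q, (p, χ, q) ∈ A.instr →
    (∀ i x, χ ≠ TInstr.dropPeb i x) ∧ (∀ x, χ ≠ TInstr.retrieve x) ∧
    (∀ b i x, χ ≠ TInstr.test b (TTest.peb i x))

/-- `DPTWA^k`: tree languages accepted by deterministic `k`-head tree-walking
automata with nested pebbles. -/
def DPTWA (Sig : Type) (rank : Sig → ℕ) (k : ℕ) : Set (Set (RTree Sig rank)) :=
  {L | ∃ A : TWA Sig rank k, Deterministic A ∧ L = Lang A}

/-- `NPTWA^k`: tree languages accepted by nondeterministic `k`-head tree-walking
automata with nested pebbles. -/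
def NPTWA (Sig : Type) (rank : Sig → ℕ) (k : ℕ) : Set (Set (RTree Sig rank)) :=
  {L | ∃ A : TWA Sig rank k, L = Lang A}

/-- `NTWA^k`: tree languages accepted by nondeterministic `k`-head tree-walking
automata without pebbles. -/
def NTWA (Sig : Type) (rank : Sig → ℕ) (k : ℕ) : Set (Set (RTree Sig rank)) :=
  {L | ∃ A : TWA Sig rank k, PebbleFree A ∧ L = Lang A}

end NestedPebbles

namespace NestedPebbles

section Tour
variable {C : Type}

theorem cyc_back {S : Type} {T : S → S → Prop} (det : ∀ a b c, T a b → T a c → b = c)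
    {s0 s : S} (h0 : Relation.TransGen T s0 s0) (h : Relation.ReflTransGen T s0 s) :
    Relation.TransGen T s s0 := by
  induction h with
  | refl => exact h0
  | tail _ hbc ih =>
    rename_i b c
    obtain ⟨d, hbd, hd⟩ := Relation.TransGen.head'_iff.1 ih
    have := det _ _ _ hbc hbd
    subst this
    rcases Relation.ReflTransGen.cases_head hd with h | ⟨e, he, h⟩
    · subst h; exact h0
    · exact Relation.TransGen.head' he h

theorem cyc_no_term {S : Type} {T : S → S → Prop} (det : ∀ a b c, T a b → T a c → b = c)
    {s0 s : S} (h0 : Relation.TransGen T s0 s0) (h : Relation.ReflTransGen T s0 s) :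
    ∃ s', T s s' := by
  obtain ⟨d, hbd, _⟩ := Relation.TransGen.head'_iff.1 (cyc_back det h0 h)
  exact ⟨d, hbd⟩

/-- The Euler tour around a functional graph; `(c, false)`: start exploring the predecessors
of `c`; `(c, true)`: exploration of `c` is finished. -/
inductive TT (R : C → C → Prop) (r : C → ℕ) : C × Bool → C × Bool → Prop
  | first (c d : C) : R d c → (∀ d', R d' c → r d ≤ r d') → TT R r (c, false) (d, false)
  | leaf (c : C) : (∀ d, ¬ R d c) → TT R r (c, false) (c, true)
  | next (c d p : C) : R c p → R d p → r c < r d →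
      (∀ d', R d' p → r c < r d' → r d ≤ r d') → TT R r (c, true) (d, false)
  | up (c p : C) : R c p → (∀ d, R d p → r d ≤ r c) → TT R r (c, true) (p, true)

variable {R : C → C → Prop} {r : C → ℕ}

theorem TT_inj (det : ∀ a b c, R a b → R a c → b = c) (hr : Function.Injective r)
    {s s' u : C × Bool} (h : TT R r s u) (h' : TT R r s' u) : s = s' := by
  have key : ∀ a b, r a ≤ r b → r b ≤ r a → a = b := fun a b h1 h2 => hr (le_antisymm h1 h2)
  cases h with
  | first c d h1 h2 =>
    cases h' with
    | first c' _ h1' h2' => rw [det _ _ _ h1 h1']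
    | next c' _ p h1' h2' h3' h4' =>
      have := det _ _ _ h1 h2'; subst this
      have := h2 _ h1'; omega
  | leaf c h1 =>
    cases h' with
    | leaf _ _ => rfl
    | up c' _ h1' _ => exact absurd h1' (h1 _)
  | next c d p h1 h2 h3 h4 =>
    cases h' with
    | first c' _ h1' h2' =>
      have := det _ _ _ h2 h1'; subst this
      have := h2' _ h1; omega
    | next c' _ p' h1' h2' h3' h4' =>
      have := det _ _ _ h2 h2'; subst this
      have : c = c' := by
        apply hr
        by_contra hne
        rcases Nat.lt_or_gt_of_ne hne with h | h
        · have := h4 _ h1' h; omega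
        · have := h4' _ h1 h; omega
      rw [this]
  | up c p h1 h2 =>
    cases h' with
    | leaf _ h => exact absurd h1 (h _)
    | up c' _ h1' h2' => rw [key c c' (h2' _ h1) (h2 _ h1')]

theorem TT_det (det : ∀ a b c, R a b → R a c → b = c) (hr : Function.Injective r)
    (s u u' : C × Bool) (h : TT R r s u) (h' : TT R r s u') : u = u' := by
  have key : ∀ a b, r a ≤ r b → r b ≤ r a → a = b := fun a b h1 h2 => hr (le_antisymm h1 h2)
  cases h with
  | first c d h1 h2 =>
    cases h' with
    | first _ d' h1' h2' => rw [key d d' (h2 _ h1') (h2' _ h1)]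
    | leaf _ h => exact absurd h1 (h _)
  | leaf c h1 =>
    cases h' with
    | leaf _ _ => rfl
    | first _ d' h1' _ => exact absurd h1' (h1 _)
  | next c d p h1 h2 h3 h4 =>
    cases h' with
    | next _ d' p' h1' h2' h3' h4' =>
      have := det _ _ _ h1 h1'; subst this
      rw [key d d' (h4 _ h2' h3') (h4' _ h2 h3)]
    | up _ p' h1' h2' =>
      have := det _ _ _ h1 h1'; subst this
      have := h2' _ h2; omega
  | up c p h1 h2 =>
    cases h' with
    | next _ d' p' h1' h2' h3' h4' =>
      have := det _ _ _ h1 h1'; subst this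
      have := h2 _ h2'; omega
    | up _ p' h1' h2' => rw [det _ _ _ h1 h1']

theorem exists_minR (P : C → Prop) (h : ∃ d, P d) (r : C → ℕ) :
    ∃ d, P d ∧ ∀ d', P d' → r d ≤ r d' := by
  obtain ⟨d, hd, hm⟩ := WellFounded.has_min (measure r).wf {d | P d} h
  exact ⟨d, hd, fun d' hd' => Nat.le_of_not_lt (hm d' hd')⟩

theorem TT_total (s : C × Bool) (h : ¬ (s.2 = true ∧ ∀ c, ¬ R s.1 c)) :
    ∃ s', TT R r s s' := by
  obtain ⟨c, b⟩ := s
  cases b with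
  | false =>
    by_cases hp : ∃ d, R d c
    · obtain ⟨d, hd, hm⟩ := exists_minR (fun d => R d c) hp r
      exact ⟨_, .first c d hd hm⟩
    · push Not at hp
      exact ⟨_, .leaf c hp⟩
  | true =>
    have : ∃ p, R c p := by
      by_contra hh; push Not at hh; exact h ⟨rfl, hh⟩
    obtain ⟨p, hp⟩ := this
    by_cases hd : ∃ d, R d p ∧ r c < r d
    · obtain ⟨d, hd, hm⟩ := exists_minR (fun d => R d p ∧ r c < r d) hd r
      exact ⟨_, .next c d p hp hd.1 hd.2 (fun d' h1 h2 => hm d' ⟨h1, h2⟩)⟩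
    · push Not at hd
      exact ⟨_, .up c p hp hd⟩

/-- Outcome of the tour started at `s0`. -/
inductive Tour (R : C → C → Prop) (r : C → ℕ) (s0 : C × Bool) : C × Bool → Option C → Prop
  | halted (h : C) : (∀ c, ¬ R h c) → Tour R r s0 (h, true) (some h)
  | back (s : C × Bool) : TT R r s s0 → Tour R r s0 s none
  | step (s s' : C × Bool) (o : Option C) : TT R r s s' → s' ≠ s0 → Tour R r s0 s' o →
      Tour R r s0 s o

theorem exists_tour [Finite C] (det : ∀ a b c, R a b → R a c → b = c)
    (hr : Function.Injective r) (s0 : C × Bool) : ∃ o, Tour R r s0 s0 o := by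
  classical
  have := Fintype.ofFinite C
  suffices H : ∀ (n : ℕ) (V : Finset (C × Bool)) (s : C × Bool), (Finset.univ \ V).card = n →
      s ∈ V → (∀ v ∈ V, v ≠ s0 → ∃ u ∈ V, u ≠ s ∧ TT R r u v) → ∃ o, Tour R r s0 s o from
    H _ {s0} s0 rfl (by simp) (by simp)
  intro n
  induction n using Nat.strong_induction_on with
  | _ n ih =>
    intro V s hn hs hV
    by_cases ht : s.2 = true ∧ ∀ c, ¬ R s.1 c
    · obtain ⟨c, b⟩ := s
      simp only at ht
      obtain ⟨rfl, ht⟩ := ht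
      exact ⟨_, .halted c ht⟩
    obtain ⟨s', hs'⟩ := TT_total (r := r) s ht
    by_cases h0 : s' = s0
    · subst h0; exact ⟨_, .back s hs'⟩
    have hnot : s' ∉ V := by
      intro hin
      obtain ⟨u, _, hne, hu⟩ := hV s' hin h0
      exact hne (TT_inj det hr hu hs')
    have hlt : (Finset.univ \ (insert s' V)).card < n := by
      rw [← hn]
      apply Finset.card_lt_card
      refine ⟨fun x hx => ?_, fun hh => ?_⟩
      · simp only [Finset.mem_sdiff, Finset.mem_insert, not_or] at hx ⊢; exact ⟨hx.1, hx.2.2⟩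
      · have := hh (show s' ∈ Finset.univ \ V by simp [hnot])
        simp at this
    obtain ⟨o, ho⟩ := ih _ hlt (insert s' V) s' rfl (by simp) (by
      intro v hv hv0
      rcases Finset.mem_insert.1 hv with rfl | hv
      · exact ⟨s, by simp [hs], fun h => hnot (h ▸ hs), hs'⟩
      · obtain ⟨u, hu, _, huv⟩ := hV v hv hv0
        exact ⟨u, by simp [hu], fun h => hnot (h ▸ hu), huv⟩)
    exact ⟨o, .step s s' o hs' h0 ho⟩

theorem reach_step (det : ∀ a b c, R a b → R a c → b = c) {a b h : C} (hab : R a b)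
    (ht : ∀ c, ¬ R h c) (hr : Relation.ReflTransGen R a h) : Relation.ReflTransGen R b h := by
  rcases Relation.ReflTransGen.cases_head hr with rfl | ⟨e, he, h⟩
  · exact absurd hab (ht _)
  · rw [det _ _ _ hab he]; exact h

theorem TT_conn (det : ∀ a b c, R a b → R a c → b = c) {h : C} (ht : ∀ c, ¬ R h c)
    {s s' : C × Bool} (hs : TT R r s s') (hr : Relation.ReflTransGen R s'.1 h) :
    Relation.ReflTransGen R s.1 h := by
  cases hs with
  | first c d h1 h2 => exact reach_step det h1 ht hr
  | leaf c h1 => exact hr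
  | next c d p h1 h2 h3 h4 => exact .head h1 (reach_step det h2 ht hr)
  | up c p h1 h2 => exact .head h1 hr

theorem tour_some (det : ∀ a b c, R a b → R a c → b = c) {s0 s : C × Bool} {h : C}
    (H : Tour R r s0 s (some h)) : Relation.ReflTransGen R s.1 h ∧ ∀ c, ¬ R h c := by
  generalize ho : some h = o at H
  induction H with
  | halted h' ht => cases ho; exact ⟨.refl, ht⟩
  | back s _ => cases ho
  | step s s' o h1 _ _ ih =>
    obtain ⟨h2, h3⟩ := ih ho
    exact ⟨TT_conn det h3 h1 h2, h3⟩

theorem tour_none_cyc {s0 s : C × Bool} (H : Tour R r s0 s none) :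
    Relation.TransGen (TT R r) s s0 := by
  generalize ho : (none : Option C) = o at H
  induction H with
  | halted h' ht => cases ho
  | back s h => exact .single h
  | step s s' o h1 _ _ ih => exact .head h1 (ih ho)

theorem explore [Finite C] (det : ∀ a b c, R a b → R a c → b = c)
    {h : C} (ht : ∀ c, ¬ R h c) :
    ∀ c, Relation.ReflTransGen R c h → Relation.ReflTransGen (TT R r) (c, false) (c, true) := by
  have := Fintype.ofFinite C
  let W : C → C → Prop := fun a b => Relation.TransGen R a b ∧ Relation.ReflTransGen R b h
  have wf : WellFounded W := by
    have : IsTrans C W := ⟨fun a b c h1 h2 => ⟨h1.1.trans h2.1, h2.2⟩⟩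
    have : Std.Irrefl W := ⟨fun a ha => by
      obtain ⟨s', hs'⟩ := cyc_no_term det ha.1 ha.2
      exact ht _ hs'⟩
    exact Finite.wellFounded_of_trans_of_irrefl W
  intro c
  induction c using wf.induction with
  | _ c ih =>
    intro hc
    have key : ∀ (n : ℕ) (d : C), (Finset.univ.sup r) - r d = n → R d c →
        Relation.ReflTransGen (TT R r) (d, false) (c, true) := by
      intro n
      induction n using Nat.strong_induction_on with
      | _ n ihn =>
        intro d hn hd
        have h1 := ih d ⟨.single hd, hc⟩ (.head hd hc)
        refine h1.trans ?_
        obtain ⟨s', hs'⟩ := TT_total (R := R) (r := r) (d, true)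
          (fun hh => hh.2 _ hd)
        cases hs' with
        | next _ d' p h1 h2 h3 h4 =>
          have := det _ _ _ h1 hd; subst this
          refine .head (.next d d' p h1 h2 h3 h4) (ihn _ ?_ d' rfl h2)
          have := Finset.le_sup (f := r) (Finset.mem_univ d')
          omega
        | up _ p h1 h2 =>
          have := det _ _ _ h1 hd; subst this
          exact .single (.up _ _ h1 h2)
    obtain ⟨s', hs'⟩ := TT_total (R := R) (r := r) (c, false) (by simp)
    cases hs' with
    | first _ d h1 h2 => exact .head (.first _ _ h1 h2) (key _ d rfl h1)
    | leaf _ h1 => exact .single (.leaf _ h1)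

theorem tour_complete [Finite C] (det : ∀ a b c, R a b → R a c → b = c)
    {h : C} (ht : ∀ c, ¬ R h c) (c : C) (hc : Relation.ReflTransGen R c h) :
    Relation.ReflTransGen (TT R r) (c, true) (h, true) := by
  induction hc using Relation.ReflTransGen.head_induction_on with
  | refl => exact .refl
  | head hab hb ih =>
    rename_i a b
    refine Relation.ReflTransGen.trans ?_ ih
    have := Fintype.ofFinite C
    have key : ∀ (n : ℕ) (d : C), (Finset.univ.sup r) - r d = n → R d b →
        Relation.ReflTransGen (TT R r) (d, true) (b, true) := by
      intro n
      induction n using Nat.strong_induction_on with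
      | _ n ihn =>
        intro d hn hd
        obtain ⟨s', hs'⟩ := TT_total (R := R) (r := r) (d, true)
          (fun hh => hh.2 _ hd)
        cases hs' with
        | next _ d' p h1 h2 h3 h4 =>
          have := det _ _ _ h1 hd; subst this
          refine .head (.next d d' p h1 h2 h3 h4) ?_
          refine (explore det ht d' (.head h2 hb)).trans (ihn _ ?_ d' rfl h2)
          have := Finset.le_sup (f := r) (Finset.mem_univ d')
          omega
        | up _ p h1 h2 =>
          have := det _ _ _ h1 hd; subst this
          exact .single (.up _ _ h1 h2)
    exact key _ a rfl hab

theorem tour_none [Finite C] (det : ∀ a b c, R a b → R a c → b = c)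
    (hr : Function.Injective r) {c0 : C} (H : Tour R r (c0, true) (c0, true) none) :
    ¬ ∃ h, Relation.ReflTransGen R c0 h ∧ ∀ c, ¬ R h c := by
  rintro ⟨h, h1, h2⟩
  obtain ⟨s', hs'⟩ := cyc_no_term (TT_det det hr) (tour_none_cyc H) (tour_complete (r := r) det h2 c0 h1)
  cases hs' with
  | next _ d' p h1 _ _ _ => exact h2 _ h1
  | up _ p h1 _ => exact h2 _ h1

end Tour
end NestedPebbles

namespace NestedPebbles

section Positions
variable {Sig : Type} {rank : Sig → ℕ}

theorem lt_snoc_iff (j : ℕ) : ∀ (s q : List ℕ), q < s ++ [j] ↔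
    q < s ∨ q = s ∨ ∃ i < j, s ++ [i] <+: q
  | [], [] => by simp
  | [], b :: q => by
    simp [List.cons_lt_cons_iff]
  | a :: s, [] => by simp
  | a :: s, b :: q => by
    simp only [List.cons_append, List.cons_lt_cons_iff, lt_snoc_iff j s q, List.cons.injEq,
      List.cons_prefix_cons]
    constructor
    · rintro (h | ⟨rfl, h | h | ⟨i, hi, h⟩⟩)
      · exact .inl (.inl h)
      · exact .inl (.inr ⟨rfl, h⟩)
      · exact .inr (.inl ⟨rfl, h⟩)
      · exact .inr (.inr ⟨i, hi, rfl, h⟩)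
    · rintro ((h | ⟨rfl, h⟩) | ⟨rfl, h⟩ | ⟨i, hi, rfl, h⟩)
      · exact .inl h
      · exact .inr ⟨rfl, .inl h⟩
      · exact .inr ⟨rfl, .inr (.inl h)⟩
      · exact .inr ⟨rfl, .inr (.inr ⟨i, hi, h⟩)⟩

theorem lt_snoc_zero (s q : List ℕ) : q < s ++ [0] ↔ q < s ∨ q = s := by
  simp [lt_snoc_iff]

theorem lt_snoc_succ (j : ℕ) (s q : List ℕ) : q < s ++ [j + 1] ↔
    q < s ++ [j] ∨ s ++ [j] <+: q := by
  rw [lt_snoc_iff, lt_snoc_iff]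
  constructor
  · rintro (h | h | ⟨i, hi, h⟩)
    · exact .inl (.inl h)
    · exact .inl (.inr (.inl h))
    · rcases Nat.lt_succ_iff_lt_or_eq.1 hi with hi | rfl
      · exact .inl (.inr (.inr ⟨i, hi, h⟩))
      · exact .inr h
  · rintro ((h | h | ⟨i, hi, h⟩) | h)
    · exact .inl h
    · exact .inr (.inl h)
    · exact .inr (.inr ⟨i, by omega, h⟩)
    · exact .inr (.inr ⟨j, by omega, h⟩)

theorem subtree_append (t : RTree Sig rank) (p q : List ℕ) :
    t.subtree (p ++ q) = (t.subtree p).bind fun s => s.subtree q := by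
  induction p generalizing t with
  | nil => rfl
  | cons i p ih =>
    simp only [List.cons_append, RTree.subtree]
    cases t.child i with
    | none => rfl
    | some s => exact ih s

theorem child_isSome (t : RTree Sig rank) (j : ℕ) :
    (t.child j).isSome = true ↔ j < rank t.label := by
  cases t with
  | node a c =>
    simp only [RTree.child, RTree.label]
    split <;> simp [*]

theorem subtree_single (t : RTree Sig rank) (j : ℕ) : t.subtree [j] = t.child j := by
  simp only [RTree.subtree]
  cases t.child j <;> rfl

theorem isPos_label {t : RTree Sig rank} {p : List ℕ} (h : IsPos t p) :
    ∃ a, labelAt t p = some a := by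
  unfold IsPos at h
  obtain ⟨s, hs⟩ := Option.isSome_iff_exists.1 h
  exact ⟨s.label, by simp [labelAt, hs]⟩

theorem isPos_snoc {t : RTree Sig rank} {p : List ℕ} {j : ℕ} :
    IsPos t (p ++ [j]) ↔ ∃ a, labelAt t p = some a ∧ j < rank a := by
  unfold IsPos labelAt
  rw [subtree_append]
  cases t.subtree p with
  | none => simp
  | some s => simp [subtree_single, child_isSome]

theorem isPos_append {t : RTree Sig rank} {p q : List ℕ} (h : IsPos t (p ++ q)) : IsPos t p := by
  unfold IsPos at h ⊢
  rw [subtree_append] at h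
  cases hh : t.subtree p with
  | none => simp [hh] at h
  | some s => rfl

theorem finite_pos (t : RTree Sig rank) : {p | IsPos t p}.Finite := by
  induction t with
  | node a c ih =>
    refine Set.Finite.subset ((Set.finite_singleton []).union
      (Set.finite_iUnion fun i : Fin (rank a) => (ih i).image (fun p => i.1 :: p))) ?_
    intro p hp
    cases p with
    | nil => exact .inl rfl
    | cons i p =>
      right
      simp only [Set.mem_ofPred_eq, IsPos, RTree.subtree, RTree.child] at hp
      split at hp
      · rename_i h
        exact Set.mem_iUnion.2 ⟨⟨i, h⟩, p, by simpa [IsPos] using hp, rfl⟩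
      · simp at hp

instance (t : RTree Sig rank) : Finite (Pos t) := (finite_pos t).to_subtype

/-- The rank of a node in preorder. -/
noncomputable def posRank (t : RTree Sig rank) (p : Pos t) : ℕ :=
  {q | IsPos t q ∧ q < p.1}.ncard

noncomputable def posCard (t : RTree Sig rank) : ℕ := {q | IsPos t q}.ncard

theorem posRank_root (t : RTree Sig rank) : posRank t (rootPos t) = 0 := by
  simp [posRank, rootPos]

theorem posRank_strict (t : RTree Sig rank) {p q : Pos t} (h : p.1 < q.1) :
    posRank t p < posRank t q := by
  apply Set.ncard_lt_ncard
  · refine ⟨fun x hx => ⟨hx.1, lt_trans hx.2 h⟩, fun hh => ?_⟩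
    exact lt_irrefl _ (hh (show p.1 ∈ _ from ⟨p.2, h⟩)).2
  · exact (finite_pos t).subset fun x hx => hx.1

theorem posRank_inj (t : RTree Sig rank) : Function.Injective (posRank t) := by
  intro p q h
  rcases lt_trichotomy p.1 q.1 with h1 | h1 | h1
  · have := posRank_strict t h1; omega
  · exact Subtype.ext h1
  · have := posRank_strict t h1; omega

theorem posRank_lt (t : RTree Sig rank) (p : Pos t) : posRank t p < posCard t := by
  apply Set.ncard_lt_ncard
  · refine ⟨fun x hx => hx.1, fun hh => ?_⟩
    exact lt_irrefl _ (hh (show p.1 ∈ _ from p.2)).2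
  · exact finite_pos t

theorem posRank_succ (t : RTree Sig rank) (p q : Pos t)
    (h : ∀ x, IsPos t x → (x < q.1 ↔ x < p.1 ∨ x = p.1)) :
    posRank t q = posRank t p + 1 := by
  unfold posRank
  rw [← Set.ncard_insert_of_notMem (a := p.1) (hs := (finite_pos t).subset fun x hx => hx.1)]
  · congr 1
    ext x
    simp only [Set.mem_ofPred_eq, Set.mem_insert_iff]
    constructor
    · rintro ⟨h1, h2⟩
      rcases (h x h1).1 h2 with h3 | h3
      · exact .inr ⟨h1, h3⟩
      · exact .inl h3
    · rintro (rfl | ⟨h1, h2⟩)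
      · exact ⟨p.2, (h _ p.2).2 (.inr rfl)⟩
      · exact ⟨h1, (h _ h1).2 (.inl h2)⟩
  · simp

theorem posRank_max (t : RTree Sig rank) (p : Pos t)
    (h : ∀ x, IsPos t x → (x < p.1 ∨ x = p.1)) :
    posRank t p + 1 = posCard t := by
  unfold posRank posCard
  rw [← Set.ncard_insert_of_notMem (a := p.1) (hs := (finite_pos t).subset fun x hx => hx.1)]
  · congr 1
    ext x
    simp only [Set.mem_ofPred_eq, Set.mem_insert_iff]
    constructor
    · rintro (rfl | ⟨h1, h2⟩)
      · exact p.2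
      · exact h1
    · intro h1
      rcases h x h1 with h3 | h3
      · exact .inr ⟨h1, h3⟩
      · exact .inl h3
  · simp

/-- Climbing from a last child to its parent. -/
theorem climb_last {t : RTree Sig rank} {s : List ℕ} {j : ℕ} {a : Sig}
    (ha : labelAt t s = some a) (hj : rank a ≤ j + 1) (q : List ℕ) (hq : IsPos t q) :
    (q < s ++ [j] ∨ s ++ [j] <+: q) ↔ (q < s ∨ s <+: q) := by
  rw [lt_snoc_iff]
  constructor
  · rintro ((h | rfl | ⟨i, hi, h⟩) | h)
    · exact .inl h
    · exact .inr (List.prefix_refl _)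
    · exact .inr ((List.prefix_append _ _).trans h)
    · exact .inr ((List.prefix_append _ _).trans h)
  · rintro (h | ⟨l, rfl⟩)
    · exact .inl (.inl h)
    · cases l with
      | nil => exact .inl (.inr (.inl (by simp)))
      | cons i l =>
        have h1 : IsPos t (s ++ [i]) := by
          apply isPos_append (q := l); simpa using hq
        obtain ⟨a', ha', hi⟩ := isPos_snoc.1 h1
        rw [ha] at ha'; cases ha'
        rcases Nat.lt_or_ge i j with h | h
        · exact .inl (.inr (.inr ⟨i, h, by simp⟩))
        · have : i = j := by omega
          subst this
          exact .inr (by simp)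

end Positions
end NestedPebbles

namespace NestedPebbles

section Fragments
variable {Sig : Type} {rank : Sig → ℕ} {k : ℕ} {X : Type}

/-- Nodes of a flow graph. -/
inductive FNode (Sig : Type) (k : ℕ) (X Q α : Type) : Type
  | act (ins : TInstr Sig k X) (q : Q)
  | br (τ : TTest Sig k X) (q1 q2 : Q)
  | ret (a : α)

/-- A program fragment with exits labelled by `α`. -/
structure Frag (Sig : Type) (k : ℕ) (X α : Type) : Type 1 where
  Q : Type
  fin : Finite Q
  entry : Q
  code : Q → FNode Sig k X Q α

abbrev Mem (t : RTree Sig rank) (k : ℕ) (X : Type) : Type :=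
  (Fin k → Pos t) × List (X × Pos t)

def NStep {Q α : Type} (t : RTree Sig rank) (code : Q → FNode Sig k X Q α)
    (c c' : Q × Mem t k X) : Prop :=
  match code c.1 with
  | .act ins q => c'.1 = q ∧ instrStep t ins c.2.1 c.2.2 c'.2.1 c'.2.2
  | .br τ q1 q2 => c'.2 = c.2 ∧ ((testHolds t τ c.2.1 c.2.2 ∧ c'.1 = q1) ∨
      (¬ testHolds t τ c.2.1 c.2.2 ∧ c'.1 = q2))
  | .ret _ => False

abbrev FStep {α : Type} (t : RTree Sig rank) (F : Frag Sig k X α)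
    (c c' : F.Q × Mem t k X) : Prop := NStep t F.code c c'

theorem lift_steps {Q Q' α β : Type} {t : RTree Sig rank} {code : Q → FNode Sig k X Q α}
    {code' : Q' → FNode Sig k X Q' β} (e : Q → Q')
    (ha : ∀ q ins q', code q = .act ins q' → code' (e q) = .act ins (e q'))
    (hb : ∀ q τ q1 q2, code q = .br τ q1 q2 → code' (e q) = .br τ (e q1) (e q2))
    {q q' : Q} {m m' : Mem t k X}
    (h : Relation.ReflTransGen (NStep t code) (q, m) (q', m')) :
    Relation.ReflTransGen (NStep t code') (e q, m) (e q', m') := by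
  refine Relation.ReflTransGen.lift (fun c : Q × Mem t k X => (e c.1, c.2)) ?_ _ _ h
  rintro ⟨q1, m1⟩ ⟨q2, m2⟩ hs
  unfold NStep at hs
  show NStep t code' (e q1, m1) (e q2, m2)
  unfold NStep
  cases hc : code q1 with
  | act ins q' => simp only [hc, ha _ _ _ hc] at hs ⊢; exact ⟨by rw [hs.1], hs.2⟩
  | br τ q1 q2 =>
    simp only [hc, hb _ _ _ _ hc] at hs ⊢
    refine ⟨hs.1, ?_⟩
    rcases hs.2 with h | h
    · exact .inl ⟨h.1, by rw [h.2]⟩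
    · exact .inr ⟨h.1, by rw [h.2]⟩
  | ret a => simp only [hc] at hs

/-- Total correctness. -/
def wp {α : Type} (t : RTree Sig rank) (F : Frag Sig k X α) (m : Mem t k X)
    (Φ : α → Mem t k X → Prop) : Prop :=
  ∃ q m', Relation.ReflTransGen (FStep t F) (F.entry, m) (q, m') ∧ ∃ a, F.code q = .ret a ∧ Φ a m'

theorem wp_mono {α : Type} {t : RTree Sig rank} {F : Frag Sig k X α} {m : Mem t k X}
    {Φ Ψ : α → Mem t k X → Prop} (h : wp t F m Φ) (hh : ∀ a m', Φ a m' → Ψ a m') :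
    wp t F m Ψ := by
  obtain ⟨q, m', h1, a, h2, h3⟩ := h
  exact ⟨q, m', h1, a, h2, hh _ _ h3⟩

def fpure {α : Type} (a : α) : Frag Sig k X α where
  Q := Unit
  fin := inferInstance
  entry := ()
  code _ := .ret a

theorem wp_pure {α : Type} {t : RTree Sig rank} {a : α} {m : Mem t k X}
    {Φ : α → Mem t k X → Prop} (h : Φ a m) : wp t (fpure a) m Φ :=
  ⟨(), m, .refl, a, rfl, h⟩

def fact (ins : TInstr Sig k X) : Frag Sig k X Unit where
  Q := Bool
  fin := inferInstance
  entry := false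
  code b := if b then .ret () else .act ins true

theorem wp_act {t : RTree Sig rank} {ins : TInstr Sig k X} {m m' : Mem t k X}
    {Φ : Unit → Mem t k X → Prop} (hi : instrStep t ins m.1 m.2 m'.1 m'.2) (h : Φ () m') :
    wp t (fact ins) m Φ :=
  ⟨true, m', .single (show FStep t (fact ins) (false, m) (true, m') from ⟨rfl, hi⟩), (), rfl, h⟩

def ftest (τ : TTest Sig k X) : Frag Sig k X Bool where
  Q := Option Bool
  fin := inferInstance
  entry := none
  code b := match b with
    | some b => .ret b
    | none => .br τ (some true) (some false)

open Classical in
theorem wp_test {t : RTree Sig rank} {τ : TTest Sig k X} {m : Mem t k X}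
    {Φ : Bool → Mem t k X → Prop} (h : Φ (decide (testHolds t τ m.1 m.2)) m) :
    wp t (ftest τ) m Φ := by
  refine ⟨some (decide (testHolds t τ m.1 m.2)), m, .single ?_, _, rfl, h⟩
  refine ⟨rfl, ?_⟩
  by_cases hh : testHolds t τ m.1 m.2
  · exact .inl ⟨hh, by simp only [hh, decide_true]; rfl⟩
  · exact .inr ⟨hh, by simp only [hh, decide_false]; rfl⟩

variable [NeZero k]

def jmp {Q α : Type} (q : Q) : FNode Sig k X Q α := .br (.chno 0 0) q q

theorem step_jmp {Q α : Type} {t : RTree Sig rank} {code : Q → FNode Sig k X Q α} {q q' : Q}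
    {m : Mem t k X} (h : code q = jmp q') : NStep t code (q, m) (q', m) := by
  unfold NStep
  simp only [h, jmp]
  refine ⟨trivial, ?_⟩
  by_cases hh : testHolds t (.chno 0 0 : TTest Sig k X) m.1 m.2
  · exact .inl ⟨hh, trivial⟩
  · exact .inr ⟨hh, trivial⟩

def bindCode {α β : Type} (F : Frag Sig k X α) (G : α → Frag Sig k X β) :
    F.Q ⊕ (Σ a, (G a).Q) → FNode Sig k X (F.Q ⊕ (Σ a, (G a).Q)) β
  | .inl q => match F.code q with
    | .act ins q' => .act ins (.inl q')
    | .br τ q1 q2 => .br τ (.inl q1) (.inl q2)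
    | .ret a => jmp (.inr ⟨a, (G a).entry⟩)
  | .inr ⟨a, q⟩ => match (G a).code q with
    | .act ins q' => .act ins (.inr ⟨a, q'⟩)
    | .br τ q1 q2 => .br τ (.inr ⟨a, q1⟩) (.inr ⟨a, q2⟩)
    | .ret b => .ret b

def fbind {α β : Type} [Finite α] (F : Frag Sig k X α) (G : α → Frag Sig k X β) :
    Frag Sig k X β where
  Q := F.Q ⊕ (Σ a, (G a).Q)
  fin := by
    have := F.fin
    have := fun a => (G a).fin
    infer_instance
  entry := .inl F.entry
  code := bindCode F G

theorem wp_bind {α β : Type} [Finite α] {t : RTree Sig rank} {F : Frag Sig k X α}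
    {G : α → Frag Sig k X β} {m : Mem t k X} {Φ : β → Mem t k X → Prop}
    (h : wp t F m (fun a m' => wp t (G a) m' Φ)) : wp t (fbind F G) m Φ := by
  obtain ⟨q, m', h1, a, h2, q', m'', h3, b, h4, h5⟩ := h
  have e1 : Relation.ReflTransGen (NStep t (bindCode F G)) (.inl F.entry, m) (.inl q, m') :=
    lift_steps (code' := bindCode F G) Sum.inl (fun q ins q' h => by simp [bindCode, h])
      (fun q τ q1 q2 h => by simp [bindCode, h]) h1
  have e2 : Relation.ReflTransGen (NStep t (bindCode F G)) (.inr ⟨a, (G a).entry⟩, m')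
      (.inr ⟨a, q'⟩, m'') :=
    lift_steps (code' := bindCode F G) (fun q => Sum.inr ⟨a, q⟩)
      (fun q ins q' h => by simp [bindCode, h])
      (fun q τ q1 q2 h => by simp [bindCode, h]) h3
  have e3 : NStep t (bindCode F G) (.inl q, m') (.inr ⟨a, (G a).entry⟩, m') :=
    step_jmp (by simp [bindCode, h2])
  have e4 : bindCode F G (.inr ⟨a, q'⟩) = .ret b := by simp [bindCode, h4]
  exact ⟨.inr ⟨a, q'⟩, m'', e1.trans (.head e3 e2), b, e4, h5⟩

def iterCode {S E : Type} (body : S → Frag Sig k X (S ⊕ E)) (q : Σ s, (body s).Q) :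
    FNode Sig k X (Σ s, (body s).Q) E :=
  match (body q.1).code q.2 with
  | .act ins q' => .act ins ⟨q.1, q'⟩
  | .br τ q1 q2 => .br τ ⟨q.1, q1⟩ ⟨q.1, q2⟩
  | .ret (.inl s) => jmp ⟨s, (body s).entry⟩
  | .ret (.inr e) => .ret e

def fiter {S E : Type} [Finite S] (body : S → Frag Sig k X (S ⊕ E)) (s0 : S) :
    Frag Sig k X E where
  Q := Σ s, (body s).Q
  fin := by
    have := fun s => (body s).fin
    infer_instance
  entry := ⟨s0, (body s0).entry⟩
  code := iterCode body

theorem wp_iter {S E : Type} [Finite S] {t : RTree Sig rank}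
    {body : S → Frag Sig k X (S ⊕ E)} {s : S} {m : Mem t k X} {Φ : E → Mem t k X → Prop}
    (h : wp t (body s) m (fun r m' => match r with
      | .inl s' => wp t (fiter body s') m' Φ
      | .inr e => Φ e m')) : wp t (fiter body s) m Φ := by
  obtain ⟨q, m', h1, a, h2, h3⟩ := h
  have e1 : Relation.ReflTransGen (NStep t (iterCode body)) (⟨s, (body s).entry⟩, m)
      (⟨s, q⟩, m') :=
    lift_steps (code' := iterCode body) (fun q => (⟨s, q⟩ : Σ s, (body s).Q))
      (fun q ins q' h => by simp [iterCode, h])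
      (fun q τ q1 q2 h => by simp [iterCode, h]) h1
  cases a with
  | inl s' =>
    obtain ⟨q', m'', h4, b, h5, h6⟩ := h3
    have e3 : NStep t (iterCode body) (⟨s, q⟩, m') (⟨s', (body s').entry⟩, m') :=
      step_jmp (by simp [iterCode, h2])
    exact ⟨q', m'', e1.trans (.head e3 h4), b, h5, h6⟩
  | inr e =>
    have e4 : iterCode body ⟨s, q⟩ = .ret e := by simp [iterCode, h2]
    exact ⟨⟨s, q⟩, m', e1, e, e4, h3⟩

end Fragments

section ToTWA
variable {Sig : Type} {rank : Sig → ℕ} {k : ℕ}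

/-- A fragment as an automaton. -/
noncomputable def toTWA (rank : Sig → ℕ) {Y : Type} [Finite Y] (F : Frag Sig k Y Bool) :
    TWA Sig rank k where
  Q := F.Q
  finQ := @Fintype.ofFinite _ F.fin
  X := Y
  finX := Fintype.ofFinite Y
  q0 := F.entry
  acc := {q | F.code q = .ret true}
  instr := {c | match F.code c.1 with
    | .act ins q => c.2 = (ins, q)
    | .br τ q1 q2 => c.2 = (.test true τ, q1) ∨ c.2 = (.test false τ, q2)
    | .ret _ => False}
  instrFin := by
    have := F.fin
    have : Set.Finite (⋃ p : F.Q, (fun x => (p, x)) '' (match F.code p with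
      | .act ins q => {(ins, q)}
      | .br τ q1 q2 => {(.test true τ, q1), (.test false τ, q2)}
      | .ret _ => ∅ : Set (TInstr Sig k Y × F.Q))) := by
      refine Set.finite_iUnion fun p => Set.Finite.image _ ?_
      cases F.code p <;> simp
    refine this.subset ?_
    rintro ⟨p, ins, q⟩ h
    refine Set.mem_iUnion.2 ⟨p, (ins, q), ?_, rfl⟩
    simp only [Set.mem_ofPred_eq] at h
    cases hc : F.code p with
    | act _ _ => simpa [hc] using h
    | br _ _ _ => simpa [hc] using h
    | ret _ => simp [hc] at h

theorem mem_toTWA {Y : Type} [Finite Y] (F : Frag Sig k Y Bool) (p : F.Q)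
    (ins : TInstr Sig k Y) (q : F.Q) : (p, ins, q) ∈ (toTWA rank F).instr ↔
    (match F.code p with
    | .act ins' q' => (ins, q) = (ins', q')
    | .br τ q1 q2 => (ins, q) = (.test true τ, q1) ∨ (ins, q) = (.test false τ, q2)
    | .ret _ => False) := Iff.rfl

theorem toTWA_det {Y : Type} [Finite Y] (F : Frag Sig k Y Bool) :
    Deterministic (toTWA rank F) := by
  intro p χ₁ q₁ χ₂ q₂ h1 h2 hne
  replace h1 := (mem_toTWA F p χ₁ q₁).1 h1
  replace h2 := (mem_toTWA F p χ₂ q₂).1 h2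
  cases hc : F.code p with
  | act _ _ =>
    simp only [hc] at h1 h2
    exact absurd (h1.trans h2.symm) hne
  | br τ a b =>
    simp only [hc] at h1 h2
    rcases h1 with h1 | h1 <;> rcases h2 with h2 | h2
    · exact absurd (h1.trans h2.symm) hne
    · cases h1; cases h2; exact .inl ⟨true, τ, rfl, rfl⟩
    · cases h1; cases h2; exact .inl ⟨false, τ, rfl, rfl⟩
    · exact absurd (h1.trans h2.symm) hne
  | ret _ => simp [hc] at h1

theorem toTWA_step {Y : Type} [Finite Y] (F : Frag Sig k Y Bool) (t : RTree Sig rank)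
    (c c' : F.Q × Mem t k Y) (h : FStep t F c c') : Step (toTWA rank F) t c c' := by
  unfold FStep NStep at h
  cases hc : F.code c.1 with
  | act ins q =>
    simp only [hc] at h
    exact ⟨ins, (mem_toTWA F _ _ _).2 (by simp [hc, h.1]), h.2⟩
  | br τ a b =>
    simp only [hc] at h
    obtain ⟨h0, h | h⟩ := h
    · exact ⟨.test true τ, (mem_toTWA F _ _ _).2 (by simp only [hc]; exact .inl (by rw [h.2]; rfl)), by rw [h0], by rw [h0], iff_of_true h.1 rfl⟩
    · exact ⟨.test false τ, (mem_toTWA F _ _ _).2 (by simp only [hc]; exact .inr (by rw [h.2]; rfl)), by rw [h0], by rw [h0], iff_of_false h.1 (by simp)⟩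
  | ret _ => simp [hc] at h

theorem toTWA_halt {Y : Type} [Finite Y] (F : Frag Sig k Y Bool) (t : RTree Sig rank)
    (c : F.Q × Mem t k Y) (b : Bool) (h : F.code c.1 = .ret b) :
    HaltingConf (toTWA rank F) t c := by
  rintro c' ⟨ins, h1, _⟩
  replace h1 := (mem_toTWA F _ _ _).1 h1
  simp [h] at h1

end ToTWA

section StepDet
variable {Sig : Type} {rank : Sig → ℕ} {k : ℕ}

theorem instrStep_det {X : Type} {t : RTree Sig rank} {ins : TInstr Sig k X}
    {hs hs1 hs2 : Fin k → Pos t} {π π1 π2 : List (X × Pos t)}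
    (h1 : instrStep t ins hs π hs1 π1) (h2 : instrStep t ins hs π hs2 π2) :
    hs1 = hs2 ∧ π1 = π2 := by
  cases ins with
  | up i =>
    obtain ⟨rfl, ⟨j, hj⟩, h⟩ := h1
    obtain ⟨rfl, ⟨j', hj'⟩, h'⟩ := h2
    refine ⟨?_, rfl⟩
    funext x
    by_cases hx : x = i
    · subst hx
      rw [hj] at hj'
      exact Subtype.ext (List.append_inj_left' hj' rfl)
    · rw [h x hx, h' x hx]
  | down i j =>
    obtain ⟨rfl, _, hj, h⟩ := h1
    obtain ⟨rfl, _, hj', h'⟩ := h2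
    refine ⟨?_, rfl⟩
    funext x
    by_cases hx : x = i
    · subst hx
      exact Subtype.ext (hj.trans hj'.symm)
    · rw [h x hx, h' x hx]
  | dropPeb i x =>
    obtain ⟨rfl, rfl, _⟩ := h1
    obtain ⟨rfl, rfl, _⟩ := h2
    exact ⟨rfl, rfl⟩
  | retrieve x =>
    obtain ⟨rfl, w, rfl⟩ := h1
    obtain ⟨rfl, w', h⟩ := h2
    cases h
    exact ⟨rfl, rfl⟩
  | test b τ =>
    obtain ⟨rfl, rfl, _⟩ := h1
    obtain ⟨rfl, rfl, _⟩ := h2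
    exact ⟨rfl, rfl⟩

theorem step_det {A : TWA Sig rank k} (hA : Deterministic A) {t : RTree Sig rank}
    (c c1 c2 : TConf A t) (h1 : Step A t c c1) (h2 : Step A t c c2) : c1 = c2 := by
  obtain ⟨q, hs, π⟩ := c
  obtain ⟨q1, hs1, π1⟩ := c1
  obtain ⟨q2, hs2, π2⟩ := c2
  obtain ⟨i1, m1, s1⟩ := h1
  obtain ⟨i2, m2, s2⟩ := h2
  by_cases he : (i1, q1) = (i2, q2)
  · cases he
    obtain ⟨rfl, rfl⟩ := instrStep_det s1 s2
    rfl
  · exfalso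
    simp only at m1 m2 s1 s2
    rcases hA _ _ _ _ _ m1 m2 he with ⟨b, τ, rfl, rfl⟩ | ⟨b, τ, rfl, rfl⟩
    · have e1 := s1.2.2; have e2 := s2.2.2
      rw [e1] at e2; cases b <;> simp at e2
    · have e1 := s1.2.2; have e2 := s2.2.2
      rw [e1] at e2; cases b <;> simp at e2

/-- Runs in a deterministic system to terminal elements are unique. -/
theorem term_unique {S : Type} {T : S → S → Prop} (det : ∀ a b c, T a b → T a c → b = c)
    {a b c : S} (hb : Relation.ReflTransGen T a b) (tb : ∀ x, ¬ T b x)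
    (hc : Relation.ReflTransGen T a c) (tc : ∀ x, ¬ T c x) : b = c := by
  induction hb using Relation.ReflTransGen.head_induction_on with
  | refl =>
    rcases Relation.ReflTransGen.cases_head hc with h | ⟨e, he, _⟩
    · exact h
    · exact absurd he (tb _)
  | head h1 _ ih => exact ih (reach_step det h1 tc hc)

theorem toTWA_accepts {Y : Type} [Finite Y] (F : Frag Sig k Y Bool)
    (t : RTree Sig rank) (P : Prop)
    (h : wp t F (fun _ => rootPos t, []) (fun b m => (b = true ↔ P) ∧
      (b = true → m = (fun _ => rootPos t, [])))) :
    (Accepts (toTWA rank F) t ↔ P) ∧ ∃ c : TConf (toTWA rank F) t,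
        Relation.ReflTransGen (Step (toTWA rank F) t) (initConf (toTWA rank F) t) c ∧
        HaltingConf (toTWA rank F) t c := by
  obtain ⟨q, m, h1, b, h2, h3, h4⟩ := h
  have hrun : Relation.ReflTransGen (Step (toTWA rank F) t) (initConf (toTWA rank F) t) (q, m) :=
    Relation.ReflTransGen.mono (fun c c' => toTWA_step F t c c') _ _ h1
  have hhalt : HaltingConf (toTWA rank F) t (q, m) := toTWA_halt F t (q, m) b h2
  refine ⟨⟨?_, ?_⟩, _, hrun, hhalt⟩
  · rintro ⟨q', hq', r', ha'⟩
    have := term_unique (step_det (toTWA_det F)) hrun hhalt r' ha'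
    cases this
    have hq' : F.code q = .ret true := hq'
    rw [h2] at hq'
    cases hq'
    exact h3.1 rfl
  · intro hP
    have hb := h3.2 hP
    subst hb
    have hm := h4 rfl
    subst hm
    exact ⟨q, h2, hrun, hhalt⟩

end StepDet
end NestedPebbles

namespace NestedPebbles

theorem childNo_nil : childNo [] = 0 := rfl

theorem childNo_snoc (p : List ℕ) (j : ℕ) : childNo (p ++ [j]) = j + 1 := by
  simp [childNo]

set_option linter.unusedSectionVars false

section Programs
variable {Sig : Type} [Finite Sig] {rank : Sig → ℕ} {k : ℕ} [NeZero k] {X : Type}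

theorem wp_seq {α β : Type} [Finite α] {t : RTree Sig rank} {F : Frag Sig k X α}
    {G : α → Frag Sig k X β} {m : Mem t k X} {Ψ : α → Mem t k X → Prop}
    {Φ : β → Mem t k X → Prop}
    (h : wp t F m Ψ) (h2 : ∀ a m', Ψ a m' → wp t (G a) m' Φ) : wp t (fbind F G) m Φ :=
  wp_bind (wp_mono h h2)

/-- The first test in a list that holds. -/
def firstTest {β : Type} (τ : β → TTest Sig k X) : List β → Frag Sig k X (Option β)
  | [] => fpure none
  | b :: l => fbind (ftest (τ b)) fun r => if r then fpure (some b) else firstTest τ l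

theorem wp_firstTest {β : Type} {t : RTree Sig rank} (τ : β → TTest Sig k X) (l : List β)
    {m : Mem t k X} {Φ : Option β → Mem t k X → Prop} (b0 : β) (hb : b0 ∈ l)
    (h : ∀ b, testHolds t (τ b) m.1 m.2 ↔ b = b0) (hΦ : Φ (some b0) m) :
    wp t (firstTest τ l) m Φ := by
  induction l with
  | nil => simp at hb
  | cons b l ih =>
    refine wp_bind (wp_test ?_)
    by_cases hh : b = b0
    · have := (h b).2 hh
      subst hh
      simpa [this] using wp_pure hΦ
    · have h1 : ¬ testHolds t (τ b) m.1 m.2 := fun h' => hh ((h b).1 h')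
      have h2 : b0 ∈ l := by
        rcases List.mem_cons.1 hb with h | h
        · exact absurd h.symm hh
        · exact h
      simpa [h1] using ih h2

/-- All tests in a list hold. -/
def allTest : List (TTest Sig k X) → Frag Sig k X Bool
  | [] => fpure true
  | τ :: l => fbind (ftest τ) fun r => if r then allTest l else fpure false

open Classical in
theorem wp_allTest {t : RTree Sig rank} (l : List (TTest Sig k X))
    {m : Mem t k X} {Φ : Bool → Mem t k X → Prop}
    (hΦ : Φ (decide (∀ τ ∈ l, testHolds t τ m.1 m.2)) m) :
    wp t (allTest l) m Φ := by
  induction l with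
  | nil => exact wp_pure (by simpa using hΦ)
  | cons τ l ih =>
    refine wp_bind (wp_test ?_)
    by_cases hh : testHolds t τ m.1 m.2
    · simp only [hh, decide_true, if_true]
      refine ih ?_
      simpa [hh] using hΦ
    · simp only [hh, decide_false]
      refine wp_pure ?_
      simpa [hh] using hΦ

noncomputable def allSig (Sig : Type) [Finite Sig] : List Sig :=
  (@Finset.univ Sig (Fintype.ofFinite Sig)).toList

theorem mem_allSig (a : Sig) : a ∈ allSig Sig := by
  simp [allSig]

noncomputable def maxRank (rank : Sig → ℕ) : ℕ :=
  (@Finset.univ Sig (Fintype.ofFinite Sig)).sup rank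

theorem le_maxRank (rank : Sig → ℕ) (a : Sig) : rank a ≤ maxRank rank :=
  Finset.le_sup (f := rank) (@Finset.mem_univ _ (Fintype.ofFinite Sig) a)

noncomputable def getLabel (i : Fin k) : Frag Sig k X (Option Sig) :=
  firstTest (fun a => .lab i a) (allSig Sig)

theorem wp_getLabel {t : RTree Sig rank} {i : Fin k} {m : Mem t k X}
    {Φ : Option Sig → Mem t k X → Prop} {a : Sig} (h : labelAt t (m.1 i).1 = some a)
    (hΦ : Φ (some a) m) : wp t (getLabel i) m Φ := by
  refine wp_firstTest _ _ a (mem_allSig a) ?_ hΦ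
  intro b
  simp only [testHolds, h, Option.some.injEq]
  exact eq_comm

noncomputable def getChno (rank : Sig → ℕ) (i : Fin k) :
    Frag Sig k X (Option (Fin (maxRank rank + 1))) :=
  firstTest (fun a => .chno i a.1) (List.finRange _)

theorem childNo_le {t : RTree Sig rank} {p : List ℕ} (h : IsPos t p) :
    childNo p ≤ maxRank rank := by
  rcases List.eq_nil_or_concat p with rfl | ⟨s, j, rfl⟩
  · simp [childNo]
  · rw [List.concat_eq_append] at h ⊢
    rw [childNo_snoc]
    obtain ⟨a, _, h2⟩ := isPos_snoc.1 h
    exact le_trans h2 (le_maxRank rank a)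

theorem wp_getChno {t : RTree Sig rank} {i : Fin k} {m : Mem t k X}
    {Φ : Option (Fin (maxRank rank + 1)) → Mem t k X → Prop}
    (hΦ : ∀ c : Fin (maxRank rank + 1), c.1 = childNo (m.1 i).1 → Φ (some c) m) :
    wp t (getChno rank i) m Φ := by
  refine wp_firstTest _ _ ⟨childNo (m.1 i).1, Nat.lt_succ_of_le (childNo_le (m.1 i).2)⟩
    (List.mem_finRange _) ?_ (hΦ _ rfl)
  intro b
  simp only [testHolds, Fin.ext_iff]
  exact eq_comm

theorem wp_down {t : RTree Sig rank} {i : Fin k} {hs : Fin k → Pos t} {π : List (X × Pos t)}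
    {Φ : Unit → Mem t k X → Prop} (j : ℕ) (p : Pos t) (hp : p.1 = (hs i).1 ++ [j])
    (hΦ : Φ () (Function.update hs i p, π)) : wp t (fact (.down i (j + 1))) (hs, π) Φ := by
  refine wp_act (m' := (Function.update hs i p, π)) ?_ hΦ
  refine ⟨rfl, by omega, ?_, ?_⟩
  · simp [hp]
  · intro h hh; simp [hh]

theorem wp_up {t : RTree Sig rank} {i : Fin k} {hs : Fin k → Pos t} {π : List (X × Pos t)}
    {Φ : Unit → Mem t k X → Prop} (j : ℕ) (p : Pos t) (hp : (hs i).1 = p.1 ++ [j])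
    (hΦ : Φ () (Function.update hs i p, π)) : wp t (fact (.up i)) (hs, π) Φ := by
  refine wp_act (m' := (Function.update hs i p, π)) ?_ hΦ
  refine ⟨rfl, ⟨j, ?_⟩, ?_⟩
  · simp [hp]
  · intro h hh; simp [hh]

noncomputable def climbBody (rank : Sig → ℕ) (i : Fin k) : Frag Sig k X (Unit ⊕ Bool) :=
  fbind (getChno rank i) fun c => match c with
    | none => fpure (.inr false)
    | some c => if c.1 = 0 then fpure (.inr false) else
      fbind (fact (.up i)) fun _ => fbind (getLabel i) fun a => match a with
        | none => fpure (.inr false)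
        | some a => if c.1 < rank a then
            fbind (fact (.down i (c.1 + 1))) fun _ => fpure (.inr true)
          else fpure (.inl ())

noncomputable def climb (rank : Sig → ℕ) (i : Fin k) : Frag Sig k X Bool :=
  fiter (fun _ : Unit => climbBody rank i) ()

/-- The outcome of moving head `i` to the document-order successor. -/
def NextSpec (t : RTree Sig rank) (i : Fin k) (hs : Fin k → Pos t) (π : List (X × Pos t))
    (p : Pos t) (b : Bool) (m' : Mem t k X) : Prop :=
  ∃ v, m' = (Function.update hs i v, π) ∧ ((b = true ∧ posRank t v = posRank t p + 1) ∨
    (b = false ∧ v = rootPos t ∧ posRank t p + 1 = posCard t))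

theorem wp_climb {t : RTree Sig rank} {i : Fin k} (p : Pos t) (π : List (X × Pos t)) (n : ℕ) :
    ∀ hs : Fin k → Pos t, (hs i).1.length = n →
      (∀ q, IsPos t q → ((q < p.1 ∨ q = p.1) ↔ (q < (hs i).1 ∨ (hs i).1 <+: q))) →
      wp t (climb rank i) (hs, π) (NextSpec t i hs π p) := by
  induction n with
  | zero =>
    intro hs hn hinv
    refine wp_iter (wp_bind (wp_getChno ?_))
    intro c hc
    have h0 : (hs i).1 = [] := List.length_eq_zero_iff.1 hn
    simp only [h0, childNo_nil] at hc
    simp only [hc, if_true]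
    refine wp_pure ?_
    refine ⟨rootPos t, ?_, .inr ⟨rfl, rfl, ?_⟩⟩
    · have : hs i = rootPos t := Subtype.ext h0
      rw [← this, Function.update_eq_self]
    · refine posRank_max t p fun x hx => ?_
      rw [hinv x hx, h0]
      exact .inr List.nil_prefix
  | succ n ih =>
    intro hs hn hinv
    refine wp_iter (wp_bind (wp_getChno ?_))
    intro c hc
    rcases List.eq_nil_or_concat (hs i).1 with h0 | ⟨s, j, h0⟩
    · simp [h0] at hn
    rw [List.concat_eq_append] at h0
    simp only [h0, childNo_snoc] at hc
    have hc0 : c.1 ≠ 0 := by omega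
    simp only [hc0, if_false]
    have hpos : IsPos t (s ++ [j]) := h0 ▸ (hs i).2
    obtain ⟨a, ha, hja⟩ := isPos_snoc.1 hpos
    obtain ⟨ps, rfl⟩ : ∃ ps : Pos t, ps.1 = s := ⟨⟨s, isPos_append hpos⟩, rfl⟩
    refine wp_bind (wp_up j ps h0 ?_)
    refine wp_bind (wp_getLabel (a := a) (by simpa using ha) ?_)
    by_cases hlt : c.1 < rank a
    · simp only [hlt, if_true]
      have hq : IsPos t (ps.1 ++ [j + 1]) := isPos_snoc.2 ⟨a, ha, by omega⟩
      obtain ⟨pq, hpq⟩ : ∃ pq : Pos t, pq.1 = ps.1 ++ [j + 1] := ⟨⟨_, hq⟩, rfl⟩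
      rw [hc]
      refine wp_bind (wp_down (j + 1) pq (by simp [hpq]) ?_)
      refine wp_pure ?_
      refine ⟨pq, by simp, .inl ⟨rfl, ?_⟩⟩
      refine posRank_succ t p _ fun x hx => ?_
      rw [hinv x hx, hpq, lt_snoc_succ, h0]
    · simp only [hlt, if_false]
      refine wp_pure ?_
      refine wp_mono (ih (Function.update hs i ps) ?_ ?_) ?_
      · have : (ps.1 ++ [j]).length = n + 1 := h0 ▸ hn
        simpa using this
      · intro q hq
        rw [hinv q hq, h0]
        have := climb_last (j := j) ha (by omega) q hq
        simpa using this
      · rintro b m' ⟨v, hv, h⟩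
        exact ⟨v, by simpa using hv, h⟩

noncomputable def nextNode (rank : Sig → ℕ) (i : Fin k) : Frag Sig k X Bool :=
  fbind (getLabel i) fun a => match a with
    | none => fpure false
    | some a => if 0 < rank a then fbind (fact (.down i (0 + 1))) fun _ => fpure true
      else climb rank i

theorem wp_nextNode {t : RTree Sig rank} {i : Fin k} (hs : Fin k → Pos t)
    (π : List (X × Pos t)) :
    wp t (nextNode rank i) (hs, π) (NextSpec t i hs π (hs i)) := by
  obtain ⟨a, ha⟩ := isPos_label (hs i).2
  refine wp_bind (wp_getLabel ha ?_)
  by_cases h0 : 0 < rank a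
  · simp only [h0, if_true]
    have hp : IsPos t ((hs i).1 ++ [0]) := isPos_snoc.2 ⟨a, ha, h0⟩
    refine wp_bind (wp_down 0 ⟨_, hp⟩ rfl (wp_pure ?_))
    refine ⟨_, rfl, .inl ⟨rfl, posRank_succ t _ _ fun x _ => lt_snoc_zero _ _⟩⟩
  · simp only [h0, if_false]
    refine wp_climb (hs i) π _ hs rfl ?_
    intro q hq
    refine or_congr_right ⟨fun h => h ▸ List.prefix_refl _, ?_⟩
    rintro ⟨r, rfl⟩
    cases r with
    | nil => simp
    | cons j r =>
      exfalso
      have : IsPos t ((hs i).1 ++ [j]) := by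
        rw [show (hs i).1 ++ j :: r = ((hs i).1 ++ [j]) ++ r by simp] at hq
        exact isPos_append hq
      obtain ⟨a', ha', hj⟩ := isPos_snoc.1 this
      rw [ha] at ha'
      cases ha'
      omega

noncomputable def gotoRoot (rank : Sig → ℕ) (i : Fin k) : Frag Sig k X Unit :=
  fiter (fun _ : Unit => fbind (nextNode rank i) fun b =>
    if b then fpure (.inl ()) else fpure (.inr ())) ()

theorem wp_gotoRoot {t : RTree Sig rank} {i : Fin k} (π : List (X × Pos t)) (n : ℕ) :
    ∀ hs : Fin k → Pos t, posCard t - posRank t (hs i) = n →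
    wp t (gotoRoot rank i) (hs, π) (fun _ m' => m' = (Function.update hs i (rootPos t), π)) := by
  induction n using Nat.strong_induction_on with
  | _ n ih =>
    intro hs hn
    refine wp_iter (wp_seq (wp_nextNode hs π) ?_)
    rintro b m' ⟨v, rfl, ⟨rfl, h⟩ | ⟨rfl, rfl, h⟩⟩
    · simp only [if_true]
      refine wp_pure ?_
      have := posRank_lt t v
      refine wp_mono (ih (posCard t - posRank t v) (by omega) _ (by simp)) ?_
      intro _ m' hm
      simpa using hm
    · exact wp_pure rfl

noncomputable def gotoPeb (rank : Sig → ℕ) (i : Fin k) (x : X) : Frag Sig k X Unit :=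
  fbind (gotoRoot rank i) fun _ =>
    fiter (fun _ : Unit => fbind (ftest (.peb i x)) fun b =>
      if b then fpure (.inr ()) else fbind (nextNode rank i) fun _ => fpure (.inl ())) ()

theorem wp_gotoPeb_aux {t : RTree Sig rank} {i : Fin k} {x : X} {π : List (X × Pos t)}
    {g : Pos t} (hg : ∀ w, (x, w) ∈ π ↔ w = g) (n : ℕ) :
    ∀ hs : Fin k → Pos t, posRank t (hs i) + n = posRank t g →
    wp t (fiter (fun _ : Unit => fbind (ftest (.peb i x)) fun b =>
      if b then fpure (.inr ()) else fbind (nextNode rank i) fun _ => fpure (.inl ())) ())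
      (hs, π) (fun _ m' => m' = (Function.update hs i g, π)) := by
  induction n with
  | zero =>
    intro hs hn
    have e : hs i = g := posRank_inj t (by simpa using hn)
    refine wp_iter (wp_bind (wp_test ?_))
    have : testHolds t (.peb i x : TTest Sig k X) hs π := (hg _).2 e
    simp only [this, decide_true, if_true]
    refine wp_pure ?_
    simp [← e]
  | succ n ih =>
    intro hs hn
    refine wp_iter (wp_bind (wp_test ?_))
    have : ¬ testHolds t (.peb i x : TTest Sig k X) hs π := by
      intro h
      have e : hs i = g := (hg _).1 h
      rw [e] at hn; omega
    simp only [this, decide_false]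
    refine wp_seq (wp_nextNode hs π) ?_
    have hlt := posRank_lt t g
    rintro b m' ⟨v, rfl, ⟨rfl, h⟩ | ⟨rfl, rfl, h⟩⟩
    · refine wp_pure ?_
      refine wp_mono (ih _ (by simp only [Function.update_self]; omega)) ?_
      intro _ m' hm
      simpa using hm
    · omega

theorem wp_gotoPeb {t : RTree Sig rank} {i : Fin k} {x : X} {π : List (X × Pos t)}
    {g : Pos t} (hg : ∀ w, (x, w) ∈ π ↔ w = g) (hs : Fin k → Pos t) :
    wp t (gotoPeb rank i x) (hs, π) (fun _ m' => m' = (Function.update hs i g, π)) := by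
  refine wp_seq (wp_gotoRoot π _ hs rfl) ?_
  rintro _ _ rfl
  refine wp_mono (wp_gotoPeb_aux hg (posRank t g) _ ?_) ?_
  · simp [posRank_root]
  · intro _ m' hm
    simpa using hm

def forHeads (f : Fin k → Frag Sig k X Unit) : List (Fin k) → Frag Sig k X Unit
  | [] => fpure ()
  | i :: l => fbind (f i) fun _ => forHeads f l

theorem wp_forHeads_aux {t : RTree Sig rank} {f : Fin k → Frag Sig k X Unit}
    {π : List (X × Pos t)} {g : Fin k → Pos t}
    (hf : ∀ i hs, wp t (f i) (hs, π) (fun _ m' => m' = (Function.update hs i (g i), π)))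
    (l : List (Fin k)) : ∀ hs : Fin k → Pos t, wp t (forHeads f l) (hs, π) (fun _ m' =>
      ∃ hs', m' = (hs', π) ∧ ∀ i, (i ∈ l ∨ hs i = g i) → hs' i = g i) := by
  induction l with
  | nil => intro hs; exact wp_pure ⟨hs, rfl, fun i h => by simpa using h⟩
  | cons j l ih =>
    intro hs
    refine wp_seq (hf j hs) ?_
    rintro _ _ rfl
    refine wp_mono (ih _) ?_
    rintro _ _ ⟨hs', rfl, h⟩
    refine ⟨hs', rfl, fun i hi => h i ?_⟩
    by_cases hij : i = j
    · subst hij; right; simp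
    · simpa [hij] using hi

theorem wp_forHeads {t : RTree Sig rank} {f : Fin k → Frag Sig k X Unit}
    {π : List (X × Pos t)} {g : Fin k → Pos t}
    (hf : ∀ i hs, wp t (f i) (hs, π) (fun _ m' => m' = (Function.update hs i (g i), π)))
    (hs : Fin k → Pos t) {Φ : Unit → Mem t k X → Prop} (hΦ : Φ () (g, π)) :
    wp t (forHeads f (List.finRange k)) (hs, π) Φ := by
  refine wp_mono (wp_forHeads_aux hf _ hs) ?_
  rintro _ _ ⟨hs', rfl, h⟩
  have : hs' = g := funext fun i => h i (.inl (List.mem_finRange i))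
  rw [this]; exact hΦ

/-- Pebbles named `m i` are exactly at the positions `g i`. -/
def MarkAt {t : RTree Sig rank} (m : Fin k → X) (g : Fin k → Pos t) (π : List (X × Pos t)) : Prop :=
  ∀ i w, (m i, w) ∈ π ↔ w = g i

noncomputable def gotoM (rank : Sig → ℕ) (m : Fin k → X) : Frag Sig k X Unit :=
  forHeads (fun i => gotoPeb rank i (m i)) (List.finRange k)

theorem wp_gotoM {t : RTree Sig rank} {m : Fin k → X} {g : Fin k → Pos t}
    {π : List (X × Pos t)} (hg : MarkAt m g π) (hs : Fin k → Pos t)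
    {Φ : Unit → Mem t k X → Prop} (hΦ : Φ () (g, π)) : wp t (gotoM rank m) (hs, π) Φ :=
  wp_forHeads (fun i hs => wp_gotoPeb (hg i) hs) hs hΦ

noncomputable def gotoRoots (rank : Sig → ℕ) : Frag Sig k X Unit :=
  forHeads (fun i => gotoRoot rank i) (List.finRange k)

theorem wp_gotoRoots {t : RTree Sig rank} {π : List (X × Pos t)} (hs : Fin k → Pos t)
    {Φ : Unit → Mem t k X → Prop} (hΦ : Φ () (fun _ => rootPos t, π)) :
    wp t (gotoRoots rank) (hs, π) Φ :=
  wp_forHeads (fun _ hs => wp_gotoRoot π _ hs rfl) hs hΦ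

def atMark (m : Fin k → X) : Frag Sig k X Bool :=
  allTest ((List.finRange k).map fun i => .peb i (m i))

open Classical in
theorem wp_atMark {t : RTree Sig rank} {m : Fin k → X} {g hs : Fin k → Pos t}
    {π : List (X × Pos t)} (hg : MarkAt m g π)
    {Φ : Bool → Mem t k X → Prop} (hΦ : Φ (decide (hs = g)) (hs, π)) :
    wp t (atMark m) (hs, π) Φ := by
  refine wp_allTest _ ?_
  have : (∀ τ ∈ (List.finRange k).map (fun i => (.peb i (m i) : TTest Sig k X)),
      testHolds t τ hs π) ↔ hs = g := by
    simp only [List.mem_map, List.mem_finRange, true_and, forall_exists_index,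
      forall_apply_eq_imp_iff, testHolds]
    rw [funext_iff]
    exact forall_congr' fun i => hg i (hs i)
  simpa only [this] using hΦ

open Classical in
theorem wp_atRoots {t : RTree Sig rank} {hs : Fin k → Pos t}
    {π : List (X × Pos t)}
    {Φ : Bool → Mem t k X → Prop} (hΦ : Φ (decide (hs = fun _ => rootPos t)) (hs, π)) :
    wp t (allTest ((List.finRange k).map fun i => .chno i 0)) (hs, π) Φ := by
  refine wp_allTest _ ?_
  have : (∀ τ ∈ (List.finRange k).map (fun i => (.chno i 0 : TTest Sig k X)),
      testHolds t τ hs π) ↔ hs = fun _ => rootPos t := by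
    simp only [List.mem_map, List.mem_finRange, true_and, forall_exists_index,
      forall_apply_eq_imp_iff, testHolds]
    rw [funext_iff]
    refine forall_congr' fun i => ?_
    constructor
    · intro h
      apply Subtype.ext
      rcases List.eq_nil_or_concat (hs i).1 with h0 | ⟨s, j, h0⟩
      · exact h0
      · rw [h0, List.concat_eq_append, childNo_snoc] at h
        omega
    · intro h; rw [h]; rfl
  simpa only [this] using hΦ

def markL (m : Fin k → X) : List (Fin k) → Frag Sig k X Unit
  | [] => fpure ()
  | i :: l => fbind (fact (.dropPeb i (m i))) fun _ => markL m l

def unmarkL (m : Fin k → X) : List (Fin k) → Frag Sig k X Unit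
  | [] => fpure ()
  | i :: l => fbind (unmarkL m l) fun _ => fact (.retrieve (m i))

def markSt {P : Type} (m : Fin k → X) (hs : Fin k → P) : List (Fin k) → List (X × P) → List (X × P)
  | [], π => π
  | i :: l, π => markSt m hs l ((m i, hs i) :: π)

theorem mem_markSt {P : Type} {m : Fin k → X} {hs : Fin k → P} (l : List (Fin k)) {x : X} {w : P} :
    ∀ {π : List (X × P)}, (x, w) ∈ markSt m hs l π ↔ (∃ i ∈ l, x = m i ∧ w = hs i) ∨ (x, w) ∈ π := by
  induction l with
  | nil => intro π; simp [markSt]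
  | cons j l ih =>
    intro π
    simp only [markSt, ih, List.mem_cons, Prod.mk.injEq, exists_eq_or_imp]
    rw [or_left_comm, or_assoc]

theorem wp_markL {t : RTree Sig rank} {m : Fin k → X} (hm : Function.Injective m)
    {hs : Fin k → Pos t} (l : List (Fin k)) :
    ∀ {π : List (X × Pos t)}, l.Nodup → (∀ i ∈ l, ∀ w, (m i, w) ∉ π) →
    wp t (markL m l) (hs, π) (fun _ m' => m' = (hs, markSt m hs l π)) := by
  induction l with
  | nil => intro π _ _; exact wp_pure rfl
  | cons i l ih =>
    intro π hl hπ
    refine wp_bind (wp_act (m' := (hs, (m i, hs i) :: π)) ⟨rfl, rfl, hπ i (by simp)⟩ ?_)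
    refine ih (List.nodup_cons.1 hl).2 ?_
    intro j hj w hw
    rcases List.mem_cons.1 hw with h | h
    · have : j = i := hm (Prod.mk.inj h).1
      subst this
      exact (List.nodup_cons.1 hl).1 hj
    · exact hπ j (by simp [hj]) w h

theorem wp_unmarkL {t : RTree Sig rank} {m : Fin k → X}
    {hs hs' : Fin k → Pos t} (l : List (Fin k)) :
    ∀ {π : List (X × Pos t)},
    wp t (unmarkL m l) (hs', markSt m hs l π) (fun _ m' => m' = (hs', π)) := by
  induction l with
  | nil => intro π; exact wp_pure rfl
  | cons i l ih =>
    intro π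
    refine wp_seq ih ?_
    rintro _ _ rfl
    exact wp_act (m' := (hs', π)) ⟨rfl, _, rfl⟩ rfl

def mark (m : Fin k → X) : Frag Sig k X Unit := markL m (List.finRange k)
def unmark (m : Fin k → X) : Frag Sig k X Unit := unmarkL m (List.finRange k)
def pushM {P : Type} (m : Fin k → X) (hs : Fin k → P) (π : List (X × P)) : List (X × P) :=
  markSt m hs (List.finRange k) π

theorem mem_pushM {P : Type} {m : Fin k → X} {hs : Fin k → P} {x : X} {w : P}
    {π : List (X × P)} : (x, w) ∈ pushM m hs π ↔ (∃ i, x = m i ∧ w = hs i) ∨ (x, w) ∈ π := by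
  simp [pushM, mem_markSt]

theorem wp_mark {t : RTree Sig rank} {m : Fin k → X} (hm : Function.Injective m)
    {hs : Fin k → Pos t} {π : List (X × Pos t)} (hπ : ∀ i w, (m i, w) ∉ π)
    {Φ : Unit → Mem t k X → Prop} (hΦ : Φ () (hs, pushM m hs π)) :
    wp t (mark m) (hs, π) Φ := by
  refine wp_mono (wp_markL hm _ (List.nodup_finRange k) fun i _ => hπ i) ?_
  rintro _ _ rfl; exact hΦ

theorem wp_unmark {t : RTree Sig rank} {m : Fin k → X}
    {hs hs' : Fin k → Pos t} {π : List (X × Pos t)}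
    {Φ : Unit → Mem t k X → Prop} (hΦ : Φ () (hs', π)) :
    wp t (unmark m) (hs', pushM m hs π) Φ := by
  refine wp_mono (wp_unmarkL _) ?_
  rintro _ _ rfl; exact hΦ

theorem markAt_pushM {t : RTree Sig rank} {m : Fin k → X} (hm : Function.Injective m)
    {hs : Fin k → Pos t} {π : List (X × Pos t)} (hπ : ∀ i w, (m i, w) ∉ π) :
    MarkAt m hs (pushM m hs π) := by
  intro i w
  rw [mem_pushM]
  constructor
  · rintro (⟨j, h1, rfl⟩ | h)
    · rw [hm h1]
    · exact absurd h (hπ i w)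
  · rintro rfl; exact .inl ⟨i, rfl, rfl⟩

theorem markAt_other {t : RTree Sig rank} {m m' : Fin k → X} (hm : ∀ i j, m i ≠ m' j)
    {g hs : Fin k → Pos t} {π : List (X × Pos t)} (h : MarkAt m g π) :
    MarkAt m g (pushM m' hs π) := by
  intro i w
  rw [mem_pushM, ← h i w]
  constructor
  · rintro (⟨j, h1, _⟩ | h)
    · exact absurd h1 (hm i j)
    · exact h
  · exact .inr

/-! ### enumeration of configurations -/

noncomputable def inc (rank : Sig → ℕ) : List (Fin k) → Frag Sig k X Bool
  | [] => fpure false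
  | i :: l => fbind (nextNode rank i) fun b => if b then fpure true else inc rank l

noncomputable def valL (t : RTree Sig rank) (hs : Fin k → Pos t) : List (Fin k) → ℕ
  | [] => 0
  | i :: l => posRank t (hs i) + posCard t * valL t hs l

theorem valL_congr {t : RTree Sig rank} {hs hs' : Fin k → Pos t} (l : List (Fin k))
    (h : ∀ i ∈ l, hs i = hs' i) : valL t hs l = valL t hs' l := by
  induction l with
  | nil => rfl
  | cons i l ih =>
    simp only [valL]
    rw [h i (by simp), ih fun j hj => h j (by simp [hj])]

theorem valL_root {t : RTree Sig rank} {hs : Fin k → Pos t} (l : List (Fin k))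
    (h : ∀ i ∈ l, hs i = rootPos t) : valL t hs l = 0 := by
  induction l with
  | nil => rfl
  | cons i l ih =>
    simp only [valL]
    rw [h i (by simp), ih fun j hj => h j (by simp [hj]), posRank_root]
    rfl

theorem valL_lt {t : RTree Sig rank} {hs : Fin k → Pos t} (l : List (Fin k)) :
    valL t hs l < posCard t ^ l.length := by
  induction l with
  | nil => simp [valL]
  | cons i l ih =>
    simp only [valL, List.length_cons, pow_succ]
    have := posRank_lt t (hs i)
    nlinarith

theorem add_mul_inj {a b c d n : ℕ} (ha : a < n) (hb : b < n) (h : a + n * c = b + n * d) :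
    a = b ∧ c = d := by
  have h1 := congrArg (· % n) h
  have h2 := congrArg (· / n) h
  have hn : 0 < n := by omega
  simp only [Nat.add_mul_mod_self_left, Nat.mod_eq_of_lt ha, Nat.mod_eq_of_lt hb] at h1
  simp only [Nat.add_mul_div_left _ _ hn, Nat.div_eq_of_lt ha, Nat.div_eq_of_lt hb] at h2
  exact ⟨h1, by omega⟩

theorem valL_inj {t : RTree Sig rank} {hs hs' : Fin k → Pos t} (l : List (Fin k))
    (h : valL t hs l = valL t hs' l) : ∀ i ∈ l, hs i = hs' i := by
  induction l with
  | nil => simp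
  | cons i l ih =>
    simp only [valL] at h
    obtain ⟨h1, h2⟩ := add_mul_inj (posRank_lt t _) (posRank_lt t _) h
    intro j hj
    rcases List.mem_cons.1 hj with rfl | hj
    · exact posRank_inj t h1
    · exact ih h2 j hj

theorem wp_inc {t : RTree Sig rank} {π : List (X × Pos t)} (l : List (Fin k)) :
    ∀ hs : Fin k → Pos t, l.Nodup → wp t (inc rank l) (hs, π) (fun b m' =>
      ∃ hs', m' = (hs', π) ∧ (∀ i ∉ l, hs' i = hs i) ∧
        ((b = true ∧ valL t hs' l = valL t hs l + 1) ∨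
         (b = false ∧ valL t hs l + 1 = posCard t ^ l.length ∧ ∀ i ∈ l, hs' i = rootPos t))) := by
  induction l with
  | nil =>
    intro hs _
    exact wp_pure ⟨hs, rfl, fun _ _ => rfl, .inr ⟨rfl, by simp [valL], by simp⟩⟩
  | cons i l ih =>
    intro hs hl
    obtain ⟨hil, hl⟩ := List.nodup_cons.1 hl
    refine wp_seq (wp_nextNode hs π) ?_
    rintro b m' ⟨v, rfl, hv⟩
    have hc : valL t (Function.update hs i v) l = valL t hs l := by
      refine valL_congr l fun j hj => ?_
      have : j ≠ i := fun h => hil (h ▸ hj)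
      simp [this]
    rcases hv with ⟨rfl, h⟩ | ⟨rfl, rfl, h⟩
    · refine wp_pure ⟨_, rfl, ?_, .inl ⟨rfl, ?_⟩⟩
      · intro j hj
        have : j ≠ i := fun h => hj (by simp [h])
        simp [this]
      · simp only [valL, hc, Function.update_self, h]
        omega
    · refine wp_mono (ih _ hl) ?_
      rintro b m' ⟨hs', rfl, h1, h2⟩
      have hi : hs' i = rootPos t := by rw [h1 i hil]; simp
      refine ⟨hs', rfl, ?_, ?_⟩
      · intro j hj
        rw [h1 j fun h => hj (by simp [h])]
        have : j ≠ i := fun h => hj (by simp [h])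
        simp [this]
      · rw [hc] at h2
        rcases h2 with ⟨rfl, h2⟩ | ⟨rfl, h2, h3⟩
        · refine .inl ⟨rfl, ?_⟩
          simp only [valL, hi, posRank_root, h2]
          nlinarith
        · refine .inr ⟨rfl, ?_, ?_⟩
          · simp only [valL, List.length_cons, pow_succ, ← h2]
            nlinarith
          · intro j hj
            rcases List.mem_cons.1 hj with rfl | hj
            · exact hi
            · exact h3 j hj

variable {Q : Type} {n : ℕ}

/-- Ranks of configurations. -/
noncomputable def cRank (e : Q ≃ Fin (n + 1)) (t : RTree Sig rank) (c : Q × (Fin k → Pos t)) : ℕ :=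
  valL t c.2 (List.finRange k) + posCard t ^ k * (e c.1).1

theorem cRank_inj (e : Q ≃ Fin (n + 1)) (t : RTree Sig rank) :
    Function.Injective (cRank (k := k) e t) := by
  rintro ⟨q, hs⟩ ⟨q', hs'⟩ h
  have h1 := valL_lt (t := t) (hs := hs) (List.finRange k)
  have h2 := valL_lt (t := t) (hs := hs') (List.finRange k)
  rw [List.length_finRange] at h1 h2
  obtain ⟨h3, h4⟩ := add_mul_inj h1 h2 h
  have e1 : q = q' := e.injective (Fin.ext h4)
  have e2 : hs = hs' := funext fun i => valL_inj _ h3 i (List.mem_finRange i)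
  rw [e1, e2]

noncomputable def firstC (rank : Sig → ℕ) (e : Q ≃ Fin (n + 1)) : Frag Sig k X Q :=
  fbind (gotoRoots rank) fun _ => fpure (e.symm 0)

theorem wp_firstC (e : Q ≃ Fin (n + 1)) {t : RTree Sig rank} {π : List (X × Pos t)}
    (hs : Fin k → Pos t) {Φ : Q → Mem t k X → Prop}
    (hΦ : ∀ q hs', cRank e t (q, hs') = 0 → Φ q (hs', π)) :
    wp t (firstC rank e) (hs, π) Φ := by
  refine wp_bind (wp_gotoRoots hs (wp_pure (hΦ _ _ ?_)))
  simp only [cRank]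
  rw [valL_root _ fun i _ => rfl]
  simp

noncomputable def nextC (rank : Sig → ℕ) (e : Q ≃ Fin (n + 1)) (q : Q) : Frag Sig k X (Option Q) :=
  fbind (inc rank (List.finRange k)) fun b => if b then fpure (some q) else
    if h : (e q).1 + 1 < n + 1 then fpure (some (e.symm ⟨(e q).1 + 1, h⟩)) else fpure none

theorem wp_nextC (e : Q ≃ Fin (n + 1)) {t : RTree Sig rank} {π : List (X × Pos t)}
    (q : Q) (hs : Fin k → Pos t) :
    wp t (nextC rank e q) (hs, π) (fun o m' => ∃ hs', m' = (hs', π) ∧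
      ((∃ q', o = some q' ∧ cRank e t (q', hs') = cRank e t (q, hs) + 1) ∨
       (o = none ∧ ∀ c : Q × (Fin k → Pos t), cRank e t c ≤ cRank e t (q, hs)))) := by
  refine wp_seq (wp_inc _ hs (List.nodup_finRange k)) ?_
  rintro b m' ⟨hs', rfl, -, ⟨rfl, h⟩ | ⟨rfl, h, h'⟩⟩
  · refine wp_pure ⟨hs', rfl, .inl ⟨q, rfl, ?_⟩⟩
    simp only [cRank, h]; omega
  · rw [List.length_finRange] at h
    simp only [Bool.false_eq_true, if_false]
    split_ifs with hlt
    · refine wp_pure ⟨hs', rfl, .inl ⟨_, rfl, ?_⟩⟩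
      simp only [cRank, valL_root _ h', Equiv.apply_symm_apply, ← h]
      nlinarith
    · refine wp_pure ⟨hs', rfl, .inr ⟨rfl, ?_⟩⟩
      rintro ⟨q2, hs2⟩
      have h1 := valL_lt (t := t) (hs := hs2) (List.finRange k)
      rw [List.length_finRange] at h1
      have h2 : (e q2).1 ≤ (e q).1 := by have := (e q2).2; omega
      simp only [cRank]
      have := Nat.mul_le_mul_left (posCard t ^ k) h2
      omega

end Programs
end NestedPebbles

namespace NestedPebbles

section Macro
variable {Sig : Type} {rank : Sig → ℕ} {k : ℕ} (A : TWA Sig rank k) (t : RTree Sig rank)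

abbrev Cf : Type := A.Q × (Fin k → Pos t)

variable {A t} in
abbrev cf (c : Cf A t) (π : List (A.X × Pos t)) : TConf A t := (c.1, c.2, π)

/-- Macro steps: a single step at the current pebble level, or an excursion with one more pebble. -/
def MStep : ℕ → List (A.X × Pos t) → Cf A t → Cf A t → Prop
  | 0, π, c, c' => Step A t (cf c π) (cf c' π)
  | n + 1, π, c, c' => Step A t (cf c π) (cf c' π) ∨ ∃ c1 c2 x w,
      Step A t (cf c π) (cf c1 ((x, w) :: π)) ∧
      Relation.ReflTransGen (MStep n ((x, w) :: π)) c1 c2 ∧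
      Step A t (cf c2 ((x, w) :: π)) (cf c' π)

variable {A t}

theorem MStep_of_step {n : ℕ} {π : List (A.X × Pos t)} {c c' : Cf A t}
    (h : Step A t (cf c π) (cf c' π)) : MStep A t n π c c' := by
  cases n with
  | zero => exact h
  | succ n => exact .inl h

theorem MStep_first {n : ℕ} {π : List (A.X × Pos t)} {c c' : Cf A t}
    (h : MStep A t n π c c') : ∃ d σ, Step A t (cf c π) (cf d σ) ∧ π.length ≤ σ.length := by
  cases n with
  | zero => exact ⟨c', π, h, le_rfl⟩
  | succ n =>
    rcases h with h | ⟨c1, c2, x, w, h, -, -⟩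
    · exact ⟨c', π, h, le_rfl⟩
    · exact ⟨c1, _, h, by simp⟩

theorem pop_term (hA : Deterministic A) {n : ℕ} {π : List (A.X × Pos t)} {c c' : Cf A t}
    {y : A.X × Pos t} (h : Step A t (cf c (y :: π)) (cf c' π)) (d : Cf A t) :
    ¬ MStep A t n (y :: π) c d := by
  intro h'
  obtain ⟨e, σ, h1, h2⟩ := MStep_first h'
  have := step_det hA _ _ _ h h1
  have : π = σ := congrArg (fun c => c.2.2) this
  subst this
  simp at h2

theorem MStep_det (hA : Deterministic A) (n : ℕ) : ∀ (π : List (A.X × Pos t)) (a b c : Cf A t),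
    MStep A t n π a b → MStep A t n π a c → b = c := by
  have base : ∀ (π : List (A.X × Pos t)) (a b c : Cf A t), Step A t (cf a π) (cf b π) →
      Step A t (cf a π) (cf c π) → b = c := by
    intro π a b c h1 h2
    have := step_det hA _ _ _ h1 h2
    exact congrArg (fun c : TConf A t => (c.1, c.2.1)) this
  have bad : ∀ (π : List (A.X × Pos t)) (a b c : Cf A t) y, Step A t (cf a π) (cf b π) →
      Step A t (cf a π) (cf c (y :: π)) → False := by
    intro π a b c y h1 h2
    have := step_det hA _ _ _ h1 h2
    have := congrArg (fun c : TConf A t => c.2.2.length) this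
    simp at this
  induction n with
  | zero => exact base
  | succ n ih =>
    rintro π a b c (h1 | ⟨c1, c2, x, w, h1, h2, h3⟩) (h1' | ⟨c1', c2', x', w', h1', h2', h3'⟩)
    · exact base _ _ _ _ h1 h1'
    · exact (bad _ _ _ _ _ h1 h1').elim
    · exact (bad _ _ _ _ _ h1' h1).elim
    · have e := step_det hA _ _ _ h1 h1'
      have e1 : c1 = c1' := congrArg (fun c : TConf A t => (c.1, c.2.1)) e
      have e2 : (x, w) :: π = (x', w') :: π := congrArg (fun c : TConf A t => c.2.2) e
      cases e2
      subst e1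
      have e3 := term_unique (ih _) h2 (fun d => pop_term hA h3 d) h2' (fun d => pop_term hA h3' d)
      subst e3
      have e := step_det hA _ _ _ h3 h3'
      exact congrArg (fun c : TConf A t => (c.1, c.2.1)) e

theorem MStep_sound (n : ℕ) : ∀ (π : List (A.X × Pos t)) (a b : Cf A t),
    MStep A t n π a b → Relation.ReflTransGen (Step A t) (cf a π) (cf b π) := by
  induction n with
  | zero => intro π a b h; exact .single h
  | succ n ih =>
    rintro π a b (h | ⟨c1, c2, x, w, h1, h2, h3⟩)
    · exact .single h
    · refine .head h1 (.tail ?_ h3)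
      clear h1 h3
      induction h2 with
      | refl => exact .refl
      | tail _ h ih' => exact ih'.trans (ih _ _ _ h)

theorem step_cases {c d : Cf A t} {π σ : List (A.X × Pos t)} (h : Step A t (cf c π) (cf d σ)) :
    σ = π ∨ (∃ i x w, σ = (x, w) :: π ∧ (c.1, TInstr.dropPeb i x, d.1) ∈ A.instr ∧
      ∀ w', (x, w') ∉ π) ∨ ∃ x w, π = (x, w) :: σ := by
  obtain ⟨ins, hm, hi⟩ := h
  cases ins with
  | up i => exact .inl hi.1
  | down i j => exact .inl hi.1
  | dropPeb i x => exact .inr (.inl ⟨i, x, _, hi.2.1, hm, hi.2.2⟩)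
  | retrieve x => exact .inr (.inr ⟨x, hi.2⟩)
  | test b τ => exact .inl hi.2.1

inductive Reach (N : ℕ) (c0 : Cf A t) : List (A.X × Pos t) → Cf A t → Prop
  | base (c : Cf A t) : Relation.ReflTransGen (MStep A t N []) c0 c → Reach N c0 [] c
  | push (π : List (A.X × Pos t)) (c' : Cf A t) (x : A.X) (w : Pos t) (c1 c : Cf A t) :
      Reach N c0 π c' → Step A t (cf c' π) (cf c1 ((x, w) :: π)) →
      Relation.ReflTransGen (MStep A t (N - (π.length + 1)) ((x, w) :: π)) c1 c →
      Reach N c0 ((x, w) :: π) c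

theorem Reach_ext {N : ℕ} {c0 : Cf A t} {π : List (A.X × Pos t)} {c d : Cf A t}
    (h : Reach N c0 π c) (hs : MStep A t (N - π.length) π c d) : Reach N c0 π d := by
  cases h with
  | base _ h => exact .base _ (h.tail hs)
  | push π c' x w c1 _ h1 h2 h3 => exact .push π c' x w c1 _ h1 h2 (h3.tail hs)

theorem Reach_nodup {N : ℕ} {c0 : Cf A t} {π : List (A.X × Pos t)} {c : Cf A t}
    (h : Reach N c0 π c) : (π.map Prod.fst).Nodup := by
  induction h with
  | base => simp
  | push π c' x w c1 c h1 h2 h3 ih =>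
    rcases step_cases h2 with h | ⟨i, x', w', h, -, hf⟩ | ⟨x', w', h⟩
    · simp at h
    · cases h
      simp only [List.map_cons, List.nodup_cons]
      refine ⟨?_, ih⟩
      intro hx
      obtain ⟨⟨a, b⟩, hab, rfl⟩ := List.mem_map.1 hx
      exact hf _ hab
    · have := congrArg List.length h
      simp at this
      omega

theorem Reach_step {N : ℕ} (hN : Nat.card A.X ≤ N) {c0 : Cf A t} {π σ : List (A.X × Pos t)}
    {c d : Cf A t} (h : Reach N c0 π c) (hs : Step A t (cf c π) (cf d σ)) : Reach N c0 σ d := by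
  rcases step_cases hs with rfl | ⟨i, x, w, rfl, -, -⟩ | ⟨x, w, rfl⟩
  · exact Reach_ext h (MStep_of_step hs)
  · exact .push π c x w d d h hs .refl
  · have hnd := Reach_nodup h
    have hlen : ((x, w) :: σ).length ≤ N := by
      have := A.finX
      have h1 := hnd.length_le_card
      rw [Nat.card_eq_fintype_card] at hN
      rw [List.length_map] at h1
      exact h1.trans hN
    cases h with
    | push _ c' _ _ c1 _ h1 h2 h3 =>
      refine Reach_ext h1 ?_
      simp only [List.length_cons] at hlen
      obtain ⟨n, hn⟩ : ∃ n, N - σ.length = n + 1 := ⟨N - σ.length - 1, by omega⟩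
      rw [hn]
      have hn' : N - (σ.length + 1) = n := by omega
      rw [hn'] at h3
      exact .inr ⟨c1, c, x, w, h2, h3, hs⟩

theorem reach_iff {N : ℕ} (hN : Nat.card A.X ≤ N) {c0 c : Cf A t} :
    Relation.ReflTransGen (Step A t) (cf c0 []) (cf c []) ↔
    Relation.ReflTransGen (MStep A t N []) c0 c := by
  constructor
  · intro h
    have : ∀ d : TConf A t, Relation.ReflTransGen (Step A t) (cf c0 []) d →
        Reach N c0 d.2.2 (d.1, d.2.1) := by
      intro d hd
      induction hd with
      | refl => exact .base _ .refl
      | tail _ h ih => exact Reach_step hN ih h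
    have := this _ h
    cases this with
    | base _ h => exact h
  · intro h
    induction h with
    | refl => exact .refl
    | tail _ h ih => exact ih.trans (MStep_sound _ _ _ _ h)

theorem halting_iff {N : ℕ} {c : Cf A t} : HaltingConf A t (cf c []) ↔
    (∀ d, ¬ MStep A t N [] c d) ∧ ∀ i x q, (c.1, TInstr.dropPeb i x, q) ∉ A.instr := by
  constructor
  · intro h
    refine ⟨fun d hd => ?_, fun i x q hm => ?_⟩
    · obtain ⟨e, σ, h1, -⟩ := MStep_first hd
      exact h _ h1
    · exact h (q, c.2, [(x, c.2 i)]) ⟨.dropPeb i x, hm, rfl, rfl, by simp⟩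
  · rintro ⟨h1, h2⟩ ⟨q, hs, σ⟩ hstep
    rcases step_cases (d := (q, hs)) hstep with rfl | ⟨i, x, w, -, hm, -⟩ | ⟨x, w, h⟩
    · exact h1 (q, hs) (MStep_of_step hstep)
    · exact h2 _ _ _ hm
    · cases h

theorem accepts_iff {N : ℕ} (hN : Nat.card A.X ≤ N) : Accepts A t ↔
    ∃ c : Cf A t, Relation.ReflTransGen (MStep A t N []) (A.q0, fun _ => rootPos t) c ∧
      (∀ d, ¬ MStep A t N [] c d) ∧ c.1 ∈ A.acc ∧
      (∀ i x q, (c.1, TInstr.dropPeb i x, q) ∉ A.instr) ∧ c.2 = fun _ => rootPos t := by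
  constructor
  · rintro ⟨q, hq, h1, h2⟩
    have h3 := (halting_iff (c := (q, fun _ => rootPos t)) (N := N)).1 h2
    exact ⟨(q, fun _ => rootPos t), (reach_iff hN).1 h1, h3.1, hq, h3.2, rfl⟩
  · rintro ⟨⟨q, hs⟩, h1, h2, h3, h4, rfl⟩
    exact ⟨q, h3, (reach_iff hN).2 h1, (halting_iff (c := (q, fun _ => rootPos t))).2 ⟨h2, h4⟩⟩

end Macro
end NestedPebbles

namespace NestedPebbles

set_option linter.unusedSectionVars false

section TourProg
variable {Sig : Type} [Finite Sig] {rank : Sig → ℕ} {k : ℕ} [NeZero k] {Y : Type}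
variable {Q : Type} [Finite Q] {M : ℕ}

/-- `Ap` computes the partial function `R` on the stack `σ`, restoring the stack. -/
def ApOK {t : RTree Sig rank} (R : Q × (Fin k → Pos t) → Q × (Fin k → Pos t) → Prop)
    (Ap : Q → Frag Sig k Y (Option Q)) (σ : List (Y × Pos t)) : Prop :=
  ∀ q hs, wp t (Ap q) (hs, σ) (fun o m' => ∃ hs', m' = (hs', σ) ∧
    ((∃ q', o = some q' ∧ R (q, hs) (q', hs')) ∨ (o = none ∧ ∀ c, ¬ R (q, hs) c)))

/-- `σ` extends `π` by marks only. -/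
def Ext {t : RTree Sig rank} (mk : Fin 4 → Fin k → Y) (π σ : List (Y × Pos t)) : Prop :=
  ∀ x w, (∀ j i, x ≠ mk j i) → ((x, w) ∈ σ ↔ (x, w) ∈ π)

def Free {t : RTree Sig rank} (mk : Fin 4 → Fin k → Y) (j : Fin 4) (σ : List (Y × Pos t)) : Prop :=
  ∀ i w, (mk j i, w) ∉ σ

theorem Ext_push {t : RTree Sig rank} {mk : Fin 4 → Fin k → Y} {π σ : List (Y × Pos t)}
    (h : Ext mk π σ) (j : Fin 4) (hs : Fin k → Pos t) : Ext mk π (pushM (mk j) hs σ) := by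
  intro x w hx
  rw [mem_pushM, ← h x w hx]
  constructor
  · rintro (⟨i, h1, _⟩ | h)
    · exact absurd h1 (hx j i)
    · exact h
  · exact .inr

theorem Free_push {t : RTree Sig rank} {mk : Fin 4 → Fin k → Y} (hmk : Function.Injective2 mk)
    {j j' : Fin 4} (hj : j ≠ j') {σ : List (Y × Pos t)}
    (h : Free mk j σ) (hs : Fin k → Pos t) : Free mk j (pushM (mk j') hs σ) := by
  intro i w hw
  rcases mem_pushM.1 hw with ⟨i', h1, _⟩ | h'
  · exact hj (hmk h1).1
  · exact h i w h'

variable (rank) (e : Q ≃ Fin (M + 1)) (mk : Fin 4 → Fin k → Y) (Ap : Q → Frag Sig k Y (Option Q))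

open Classical in
noncomputable def findBody (qp q : Q) : Frag Sig k Y (Q ⊕ Option Q) :=
  fbind (mark (mk 3)) fun _ => fbind (Ap q) fun r =>
  fbind (if r = some qp then atMark (mk 2) else fpure false) fun found =>
  fbind (gotoM rank (mk 3)) fun _ => fbind (unmark (mk 3)) fun _ =>
  if found then fpure (.inr (some q)) else
    fbind (nextC rank e q) fun o => match o with
      | some q' => fpure (.inl q')
      | none => fpure (.inr none)

noncomputable def findNext (qp q : Q) : Frag Sig k Y (Option Q) :=
  fiter (findBody rank e mk Ap qp) q

open Classical in
noncomputable def checkDone (q0 q : Q) : Frag Sig k Y ((Bool × Q) ⊕ Option Q) :=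
  fbind (if q = q0 then atMark (mk 0) else fpure false) fun b =>
    if b then fpure (.inr none) else fpure (.inl (true, q))

noncomputable def bodyDown (q0 q : Q) : Frag Sig k Y ((Bool × Q) ⊕ Option Q) :=
  fbind (mark (mk 2)) fun _ => fbind (firstC rank e) fun qc =>
  fbind (findNext rank e mk Ap q qc) fun o => match o with
    | some d => fbind (unmark (mk 2)) fun _ => fpure (.inl (false, d))
    | none => fbind (gotoM rank (mk 2)) fun _ => fbind (unmark (mk 2)) fun _ => checkDone mk q0 q

noncomputable def bodyUp2 (q0 q p : Q) : Frag Sig k Y ((Bool × Q) ⊕ Option Q) :=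
  fbind (mark (mk 2)) fun _ => fbind (gotoM rank (mk 1)) fun _ =>
  fbind (nextC rank e q) fun o2 =>
  fbind (match o2 with
    | none => fpure none
    | some q' => findNext rank e mk Ap p q') fun o3 => match o3 with
    | some d => fbind (unmark (mk 2)) fun _ => fbind (unmark (mk 1)) fun _ => fpure (.inl (false, d))
    | none => fbind (gotoM rank (mk 2)) fun _ => fbind (unmark (mk 2)) fun _ =>
        fbind (unmark (mk 1)) fun _ => checkDone mk q0 p

noncomputable def bodyUp (q0 q : Q) : Frag Sig k Y ((Bool × Q) ⊕ Option Q) :=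
  fbind (mark (mk 1)) fun _ => fbind (Ap q) fun o => match o with
    | none => fbind (gotoM rank (mk 1)) fun _ => fbind (unmark (mk 1)) fun _ => fpure (.inr (some q))
    | some p => bodyUp2 rank e mk Ap q0 q p

noncomputable def tourBody (q0 : Q) (s : Bool × Q) : Frag Sig k Y ((Bool × Q) ⊕ Option Q) :=
  if s.1 then bodyUp rank e mk Ap q0 s.2 else bodyDown rank e mk Ap q0 s.2

noncomputable def evalF (q0 : Q) : Frag Sig k Y (Option Q) :=
  fbind (mark (mk 0)) fun _ => fbind (fiter (tourBody rank e mk Ap q0) (true, q0)) fun r =>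
  fbind (unmark (mk 0)) fun _ => fpure r

variable {rank e mk Ap}
variable {t : RTree Sig rank} {R : Q × (Fin k → Pos t) → Q × (Fin k → Pos t) → Prop}
  {π0 : List (Y × Pos t)}

theorem mk_inj (hmk : Function.Injective2 mk) (j : Fin 4) : Function.Injective (mk j) :=
  fun _ _ h => (hmk h).2

theorem mk_ne (hmk : Function.Injective2 mk) {j j' : Fin 4} (h : j ≠ j') (i i' : Fin k) :
    mk j i ≠ mk j' i' := fun hx => h (hmk hx).1

/-- The outcome of a search for the least `R`-predecessor of `p` with rank `≥ n`. -/
def FindSpec (e : Q ≃ Fin (M + 1)) (R : Q × (Fin k → Pos t) → Q × (Fin k → Pos t) → Prop)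
    (σ : List (Y × Pos t)) (p : Q × (Fin k → Pos t)) (n : ℕ) (o : Option Q) (m' : Mem t k Y) : Prop :=
  (∃ q' hs', o = some q' ∧ m' = (hs', σ) ∧ R (q', hs') p ∧ n ≤ cRank e t (q', hs') ∧
      ∀ c, R c p → n ≤ cRank e t c → cRank e t (q', hs') ≤ cRank e t c) ∨
  (o = none ∧ ∃ hs', m' = (hs', σ) ∧ ∀ c, R c p → ¬ n ≤ cRank e t c)

open Classical in
theorem wp_findNext (hmk : Function.Injective2 mk)
    (det : ∀ a b c, R a b → R a c → b = c)
    (hAp : ∀ σ, Ext mk π0 σ → ApOK R Ap σ) {σ : List (Y × Pos t)} (hE : Ext mk π0 σ)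
    (hF : Free mk 3 σ) {p : Q × (Fin k → Pos t)} (hy : MarkAt (mk 2) p.2 σ)
    (B : ℕ) (hB : ∀ c : Q × (Fin k → Pos t), cRank e t c ≤ B) (n : ℕ) :
    ∀ (q : Q) (hs : Fin k → Pos t), B - cRank e t (q, hs) = n →
    wp t (findNext rank e mk Ap p.1 q) (hs, σ) (FindSpec e R σ p (cRank e t (q, hs))) := by
  induction n using Nat.strong_induction_on with
  | _ n ih =>
  intro q hs hn
  refine wp_iter ?_
  refine wp_bind (wp_mark (mk_inj hmk 3) hF ?_)
  refine wp_seq (hAp _ (Ext_push hE 3 hs) q hs) ?_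
  rintro r _ ⟨hs1, rfl, hr⟩
  have hfound : wp t (if r = some p.1 then atMark (mk 2) else fpure false)
      (hs1, pushM (mk 3) hs σ) (fun b m' => m' = (hs1, pushM (mk 3) hs σ) ∧
        (b = true ↔ R (q, hs) p)) := by
    have hmy : MarkAt (mk 2) p.2 (pushM (mk 3) hs σ) :=
      markAt_other (mk_ne hmk (by decide)) hy
    split_ifs with h
    · subst h
      refine wp_atMark hmy ⟨rfl, ?_⟩
      rcases hr with ⟨q', h1, h2⟩ | ⟨h1, _⟩
      · cases h1
        rw [decide_eq_true_iff]
        constructor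
        · intro h; rw [h] at h2; exact h2
        · intro h; exact congrArg Prod.snd (det _ _ _ h2 h)
      · cases h1
    · refine wp_pure ⟨rfl, ?_⟩
      refine iff_of_false (by simp) ?_
      intro hR
      rcases hr with ⟨q', h1, h2⟩ | ⟨h1, h2⟩
      · have := det _ _ _ h2 hR
        rw [h1, ← this] at h
        exact h rfl
      · exact h2 _ hR
  refine wp_seq hfound ?_
  rintro found _ ⟨rfl, hfo⟩
  refine wp_bind (wp_gotoM (markAt_pushM (mk_inj hmk 3) hF) hs1 ?_)
  refine wp_bind (wp_unmark ?_)
  cases found with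
  | true =>
    refine wp_pure ?_
    exact .inl ⟨q, hs, rfl, rfl, hfo.1 rfl, le_rfl, fun c _ h => h⟩
  | false =>
    have hnR : ¬ R (q, hs) p := fun h => by simpa using hfo.2 h
    refine wp_seq (wp_nextC e q hs) ?_
    rintro o _ ⟨hs2, rfl, ⟨q', rfl, h⟩ | ⟨rfl, h⟩⟩
    · refine wp_pure ?_
      have hlt := hB (q', hs2)
      refine wp_mono (ih (B - cRank e t (q', hs2)) (by omega) q' hs2 rfl) ?_
      have key : ∀ c, R c p → cRank e t (q, hs) ≤ cRank e t c → cRank e t (q', hs2) ≤ cRank e t c := by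
        intro c hc hle
        have : cRank e t (q, hs) ≠ cRank e t c := by
          intro he
          have := cRank_inj e t he
          subst this
          exact hnR hc
        omega
      rintro o m' (⟨q3, hs3, h1, h2, h3, h4, h5⟩ | ⟨h1, hs3, h2, h3⟩)
      · exact .inl ⟨q3, hs3, h1, h2, h3, by omega, fun c hc hle => h5 c hc (key c hc hle)⟩
      · exact .inr ⟨h1, hs3, h2, fun c hc hle => h3 c hc (key c hc hle)⟩
    · refine wp_pure ?_
      refine .inr ⟨rfl, hs2, rfl, fun c hc hle => ?_⟩
      have he := le_antisymm hle (h c)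
      have := cRank_inj e t he
      subst this
      exact hnR hc

/-- One step of the tour. -/
def TourOut (e : Q ≃ Fin (M + 1)) (R : Q × (Fin k → Pos t) → Q × (Fin k → Pos t) → Prop)
    (c0 : Q × (Fin k → Pos t)) (σ : List (Y × Pos t))
    (s : (Q × (Fin k → Pos t)) × Bool) (r : (Bool × Q) ⊕ Option Q) (m' : Mem t k Y) : Prop :=
  ∃ hs', m' = (hs', σ) ∧ match r with
    | .inl (b, q) => TT R (cRank e t) s ((q, hs'), b) ∧ ((q, hs'), b) ≠ (c0, true)
    | .inr none => TT R (cRank e t) s (c0, true)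
    | .inr (some q) => s = ((q, hs'), true) ∧ ∀ c, ¬ R (q, hs') c

open Classical in
theorem wp_checkDone {c0 : Q × (Fin k → Pos t)} {σ : List (Y × Pos t)}
    (ha : MarkAt (mk 0) c0.2 σ) {s : (Q × (Fin k → Pos t)) × Bool} (p : Q × (Fin k → Pos t))
    (h : TT R (cRank e t) s (p, true)) :
    wp t (checkDone mk c0.1 p.1) (p.2, σ) (TourOut e R c0 σ s) := by
  have : wp t (if p.1 = c0.1 then atMark (mk 0) else fpure false)
      (p.2, σ) (fun b m' => m' = (p.2, σ) ∧ (b = true ↔ p = c0)) := by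
    split_ifs with h
    · refine wp_atMark ha ⟨rfl, ?_⟩
      rw [decide_eq_true_iff, Prod.ext_iff]
      exact ⟨fun h' => ⟨h, h'⟩, fun h' => h'.2⟩
    · exact wp_pure ⟨rfl, iff_of_false (by simp) (fun h' => h (by rw [h']))⟩
  refine wp_seq this ?_
  rintro b _ ⟨rfl, hb⟩
  cases b with
  | true => exact wp_pure ⟨p.2, rfl, hb.1 rfl ▸ h⟩
  | false =>
    refine wp_pure ⟨p.2, rfl, h, ?_⟩
    intro h'
    have := hb.2 (congrArg Prod.fst h')
    simp at this

theorem exists_bound (e : Q ≃ Fin (M + 1)) (t : RTree Sig rank) :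
    ∃ B, ∀ c : Q × (Fin k → Pos t), cRank e t c ≤ B := by
  obtain ⟨B, hB⟩ := (Set.finite_range (cRank (k := k) e t)).bddAbove
  exact ⟨B, fun c => hB ⟨c, rfl⟩⟩

theorem wp_tourBody (hmk : Function.Injective2 mk)
    (det : ∀ a b c, R a b → R a c → b = c)
    (hAp : ∀ σ, Ext mk π0 σ → ApOK R Ap σ) {σ : List (Y × Pos t)} (hE : Ext mk π0 σ)
    (hF1 : Free mk 1 σ) (hF2 : Free mk 2 σ) (hF3 : Free mk 3 σ)
    {c0 : Q × (Fin k → Pos t)} (ha : MarkAt (mk 0) c0.2 σ) (q : Q) (hs : Fin k → Pos t) (b : Bool) :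
    wp t (tourBody rank e mk Ap c0.1 (b, q)) (hs, σ) (TourOut e R c0 σ ((q, hs), b)) := by
  obtain ⟨B, hB⟩ := exists_bound (k := k) e t
  cases b with
  | false =>
    show wp t (bodyDown rank e mk Ap c0.1 q) (hs, σ) _
    refine wp_bind (wp_mark (mk_inj hmk 2) hF2 ?_)
    have hy := markAt_pushM (mk_inj hmk 2) hF2 (hs := hs)
    refine wp_bind (wp_firstC e hs ?_)
    intro qc hc h0
    refine wp_seq (wp_findNext hmk det hAp (Ext_push hE 2 hs)
      (Free_push hmk (by decide) hF3 hs) (p := (q, hs)) hy B hB _ qc hc rfl) ?_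
    rw [h0]
    rintro o _ (⟨q', hs', rfl, rfl, h1, -, h2⟩ | ⟨rfl, hs', rfl, h1⟩)
    · refine wp_bind (wp_unmark (wp_pure ?_))
      refine ⟨hs', rfl, ?_, ?_⟩
      · exact .first _ _ h1 fun d' hd' => h2 d' hd' (Nat.zero_le _)
      · intro h; have := congrArg Prod.snd h; simp at this
    · refine wp_bind (wp_gotoM hy hs' ?_)
      refine wp_bind (wp_unmark ?_)
      exact wp_checkDone ha (q, hs) (.leaf _ fun d hd => h1 d hd (Nat.zero_le _))
  | true =>
    show wp t (bodyUp rank e mk Ap c0.1 q) (hs, σ) _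
    refine wp_bind (wp_mark (mk_inj hmk 1) hF1 ?_)
    have hz := markAt_pushM (mk_inj hmk 1) hF1 (hs := hs)
    have hE1 := Ext_push hE 1 hs
    refine wp_seq (hAp _ hE1 q hs) ?_
    rintro o _ ⟨hp, rfl, ⟨qp, rfl, hR⟩ | ⟨rfl, hterm⟩⟩
    · show wp t (bodyUp2 rank e mk Ap c0.1 q qp) _ _
      have hF2' : Free mk 2 (pushM (mk 1) hs σ) := Free_push hmk (by decide) hF2 hs
      refine wp_bind (wp_mark (mk_inj hmk 2) hF2' ?_)
      have hy := markAt_pushM (mk_inj hmk 2) hF2' (hs := hp)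
      have hz' := markAt_other (hs := hp) (mk_ne hmk (show (1 : Fin 4) ≠ 2 by decide)) hz
      refine wp_bind (wp_gotoM hz' hp ?_)
      refine wp_seq (wp_nextC e q hs) ?_
      rintro o2 _ ⟨hs2, rfl, ho2⟩
      have hfind : wp t (match o2 with
          | none => fpure none
          | some q' => findNext rank e mk Ap qp q')
          (hs2, pushM (mk 2) hp (pushM (mk 1) hs σ))
          (FindSpec e R (pushM (mk 2) hp (pushM (mk 1) hs σ)) (qp, hp) (cRank e t (q, hs) + 1)) := by
        rcases ho2 with ⟨q', rfl, h⟩ | ⟨rfl, h⟩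
        · rw [← h]
          exact wp_findNext hmk det hAp (Ext_push hE1 2 hp)
            (Free_push hmk (by decide) (Free_push hmk (by decide) hF3 hs) hp)
            (p := (qp, hp)) hy B hB _ q' hs2 rfl
        · refine wp_pure (.inr ⟨rfl, hs2, rfl, fun c _ hle => ?_⟩)
          have := h c
          omega
      refine wp_seq hfind ?_
      rintro o _ (⟨q', hs', rfl, rfl, h1, h2, h3⟩ | ⟨rfl, hs', rfl, h1⟩)
      · refine wp_bind (wp_unmark (wp_bind (wp_unmark (wp_pure ?_))))
        refine ⟨hs', rfl, ?_, ?_⟩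
        · exact .next _ _ _ hR h1 h2 fun d' hd' hlt => h3 d' hd' hlt
        · intro h; have := congrArg Prod.snd h; simp at this
      · refine wp_bind (wp_gotoM hy hs' ?_)
        refine wp_bind (wp_unmark (wp_bind (wp_unmark ?_)))
        refine wp_checkDone ha (qp, hp) (.up _ _ hR fun d hd => ?_)
        have := h1 d hd
        omega
    · refine wp_bind (wp_gotoM hz hp (wp_bind (wp_unmark (wp_pure ?_))))
      exact ⟨hs, rfl, rfl, hterm⟩

theorem TT_term {r : Q × (Fin k → Pos t) → ℕ} {h : Q × (Fin k → Pos t)} (ht : ∀ c, ¬ R h c)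
    {s} (hT : TT R r (h, true) s) : False := by
  cases hT with
  | next _ _ _ h1 => exact ht _ h1
  | up _ _ h1 => exact ht _ h1

theorem wp_tour {body : Bool × Q → Frag Sig k Y ((Bool × Q) ⊕ Option Q)}
    (det : ∀ a b c, R a b → R a c → b = c) {c0 : Q × (Fin k → Pos t)} {σ : List (Y × Pos t)}
    (hbody : ∀ q hs b, wp t (body (b, q)) (hs, σ) (TourOut e R c0 σ ((q, hs), b)))
    {s : (Q × (Fin k → Pos t)) × Bool} {o : Option (Q × (Fin k → Pos t))}
    (hT : Tour R (cRank e t) (c0, true) s o) :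
    wp t (fiter body (s.2, s.1.1)) (s.1.2, σ) (fun o' m' => ∃ hs', m' = (hs', σ) ∧
      o = o'.map fun q => (q, hs')) := by
  induction hT with
  | halted h ht =>
    refine wp_iter (wp_mono (hbody h.1 h.2 true) ?_)
    rintro r m' ⟨hs', rfl, hr⟩
    rcases r with ⟨b, q⟩ | (_ | q)
    · exact (TT_term ht hr.1).elim
    · exact (TT_term ht hr).elim
    · exact ⟨hs', rfl, congrArg some (congrArg Prod.fst hr.1)⟩
  | back s hTT =>
    obtain ⟨⟨q, hs⟩, b⟩ := s
    refine wp_iter (wp_mono (hbody q hs b) ?_)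
    rintro r m' ⟨hs', rfl, hr⟩
    rcases r with ⟨b, q⟩ | (_ | q)
    · exact absurd (TT_det det (cRank_inj e t) _ _ _ hr.1 hTT) hr.2
    · exact ⟨hs', rfl, rfl⟩
    · obtain ⟨h1, h2⟩ := hr
      cases h1
      exact (TT_term h2 hTT).elim
  | step s s' o hTT hne _ ih =>
    obtain ⟨⟨q, hs⟩, b⟩ := s
    refine wp_iter (wp_mono (hbody q hs b) ?_)
    rintro r m' ⟨hs', rfl, hr⟩
    rcases r with ⟨b, q⟩ | (_ | q)
    · have := TT_det det (cRank_inj e t) _ _ _ hr.1 hTT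
      subst this
      exact ih
    · exact absurd (TT_det det (cRank_inj e t) _ _ _ hTT hr) hne
    · obtain ⟨h1, h2⟩ := hr
      cases h1
      exact (TT_term h2 hTT).elim

theorem wp_evalF (hmk : Function.Injective2 mk)
    (det : ∀ a b c, R a b → R a c → b = c)
    (hAp : ∀ σ, Ext mk π0 σ → ApOK R Ap σ) (hF : ∀ j, Free mk j π0) (q : Q) (hs : Fin k → Pos t) :
    wp t (evalF rank e mk Ap q) (hs, π0) (fun o m' => ∃ hs', m' = (hs', π0) ∧
      ((∃ q', o = some q' ∧ Relation.ReflTransGen R (q, hs) (q', hs') ∧ ∀ c, ¬ R (q', hs') c) ∨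
       (o = none ∧ ¬ ∃ h, Relation.ReflTransGen R (q, hs) h ∧ ∀ c, ¬ R h c))) := by
  refine wp_bind (wp_mark (mk_inj hmk 0) (hF 0) ?_)
  have hE : Ext mk π0 (pushM (mk 0) hs π0) := Ext_push (fun _ _ _ => Iff.rfl) 0 hs
  have hfree : ∀ j : Fin 4, j ≠ 0 → Free mk j (pushM (mk 0) hs π0) :=
    fun j hj => Free_push hmk hj (hF j) hs
  have hbody := wp_tourBody (e := e) hmk det hAp hE (hfree 1 (by decide)) (hfree 2 (by decide))
    (hfree 3 (by decide)) (c0 := (q, hs)) (markAt_pushM (mk_inj hmk 0) (hF 0))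
  obtain ⟨o, ho⟩ := exists_tour det (cRank_inj e t) ((q, hs), true)
  refine wp_seq (wp_tour det hbody ho) ?_
  rintro o' _ ⟨hs', rfl, rfl⟩
  refine wp_bind (wp_unmark (wp_pure ⟨hs', rfl, ?_⟩))
  cases o' with
  | none => exact .inr ⟨rfl, tour_none det (cRank_inj e t) ho⟩
  | some q' => exact .inl ⟨q', rfl, tour_some det ho⟩

end TourProg
end NestedPebbles

namespace NestedPebbles

set_option linter.unusedSectionVars false

section Assembly
variable {Sig : Type} [Finite Sig] {rank : Sig → ℕ} {k : ℕ} [NeZero k]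

instance instFiniteQ (A : TWA Sig rank k) : Finite A.Q := @Finite.of_fintype _ A.finQ
instance instFiniteX (A : TWA Sig rank k) : Finite A.X := @Finite.of_fintype _ A.finX

/-- The pebbles of the halting automaton. -/
abbrev PX (A : TWA Sig rank k) (N : ℕ) : Type := A.X ⊕ (Fin (N + 1) × Fin 4 × Fin k)

variable {A : TWA Sig rank k} {N : ℕ} {t : RTree Sig rank}

def mkP (A : TWA Sig rank k) (N n : ℕ) (j : Fin 4) (i : Fin k) : PX A N :=
  .inr (Fin.ofNat (N + 1) n, j, i)

theorem mkP_inj2 (n : ℕ) : Function.Injective2 (mkP A N n) := by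
  intro j j' i i' h
  simpa [mkP] using h

theorem mkP_level {n n' : ℕ} (h : n ≤ N) (h' : n' ≤ N) {j j' : Fin 4} {i i' : Fin k}
    (he : mkP A N n j i = mkP A N n' j' i') : n = n' := by
  simp only [mkP, Sum.inr.injEq, Prod.mk.injEq] at he
  have := congrArg Fin.val he.1
  simp only [Fin.ofNat] at this
  rwa [Nat.mod_eq_of_lt (by omega), Nat.mod_eq_of_lt (by omega)] at this

/-- The simulating stack represents `π`, and the marks of levels `< n` are unused. -/
def Rel (n : ℕ) (σ : List (PX A N × Pos t)) (π : List (A.X × Pos t)) : Prop :=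
  (∀ x w, (Sum.inl x, w) ∈ σ ↔ (x, w) ∈ π) ∧ ∀ n' < n, ∀ j i w, (mkP A N n' j i, w) ∉ σ

def DS (D : Set A.X) (π : List (A.X × Pos t)) : Prop := ∀ x, x ∈ D ↔ ∃ w, (x, w) ∈ π

def liftT (N : ℕ) : TTest Sig k A.X → TTest Sig k (PX A N)
  | .lab i a => .lab i a
  | .peb i x => .peb i (.inl x)
  | .chno i j => .chno i j

theorem liftT_holds {n : ℕ} {σ : List (PX A N × Pos t)} {π : List (A.X × Pos t)}
    (h : Rel n σ π) (τ : TTest Sig k A.X) (hs : Fin k → Pos t) :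
    testHolds t (liftT N τ) hs σ ↔ testHolds t τ hs π := by
  cases τ with
  | lab i a => exact Iff.rfl
  | peb i x => exact h.1 _ _
  | chno i j => exact Iff.rfl

/-- The instruction is executable and does not pop a pebble. -/
def En (ins : TInstr Sig k A.X) (hs : Fin k → Pos t) (π : List (A.X × Pos t)) : Prop :=
  ∃ hs1 π1, instrStep t ins hs π hs1 π1 ∧ π.length ≤ π1.length

open Classical in
noncomputable def enabled (A : TWA Sig rank k) (N : ℕ) (D : Set A.X) :
    TInstr Sig k A.X → Frag Sig k (PX A N) Bool
  | .up i => fbind (ftest (.chno i 0)) fun b => fpure (!b)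
  | .down i j => fbind (getLabel i) fun a => match a with
      | none => fpure false
      | some a => fpure (decide (1 ≤ j ∧ j ≤ rank a))
  | .dropPeb _ x => fpure (decide (x ∉ D))
  | .retrieve _ => fpure false
  | .test b τ => fbind (ftest (liftT N τ)) fun r => fpure (r == b)

theorem exists_update_down {i : Fin k} {hs : Fin k → Pos t} {j : ℕ} {a : Sig}
    (ha : labelAt t (hs i).1 = some a) (hj : j < rank a) :
    ∃ p : Pos t, p.1 = (hs i).1 ++ [j] := ⟨⟨_, isPos_snoc.2 ⟨a, ha, hj⟩⟩, rfl⟩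

open Classical in
theorem wp_enabled {n : ℕ} {σ : List (PX A N × Pos t)} {π : List (A.X × Pos t)}
    (h : Rel n σ π) {D : Set A.X} (hD : DS D π) (ins : TInstr Sig k A.X) (hs : Fin k → Pos t) :
    wp t (enabled A N D ins) (hs, σ) (fun b m' => m' = (hs, σ) ∧ (b = true ↔ En ins hs π)) := by
  cases ins with
  | up i =>
    refine wp_bind (wp_test (wp_pure ⟨rfl, ?_⟩))
    rw [Bool.not_eq_true', decide_eq_false_iff_not]
    change ¬ (childNo (hs i).1 = 0) ↔ _
    constructor
    · intro hc
      rcases List.eq_nil_or_concat (hs i).1 with h0 | ⟨s, j, h0⟩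
      · rw [h0] at hc; exact absurd rfl hc
      · rw [List.concat_eq_append] at h0
        obtain ⟨p, rfl⟩ : ∃ p : Pos t, p.1 = s :=
          ⟨⟨s, isPos_append (h0 ▸ (hs i).2)⟩, rfl⟩
        refine ⟨Function.update hs i p, π, ⟨rfl, ⟨j, ?_⟩, ?_⟩, le_rfl⟩
        · simpa using h0
        · intro h hh; simp [hh]
    · rintro ⟨hs1, π1, ⟨-, ⟨j, hj⟩, -⟩, -⟩ hc
      rw [hj, childNo_snoc] at hc
      omega
  | down i j =>
    obtain ⟨a, ha⟩ := isPos_label (hs i).2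
    refine wp_bind (wp_getLabel ha (wp_pure ⟨rfl, ?_⟩))
    rw [decide_eq_true_iff]
    constructor
    · rintro ⟨h1, h2⟩
      obtain ⟨p, hp⟩ := exists_update_down ha (show j - 1 < rank a by omega)
      refine ⟨Function.update hs i p, π, ⟨rfl, h1, ?_, ?_⟩, le_rfl⟩
      · simpa using hp
      · intro h hh; simp [hh]
    · rintro ⟨hs1, π1, ⟨-, h1, h2, -⟩, -⟩
      have := (hs1 i).2
      rw [h2] at this
      obtain ⟨a', ha', hj⟩ := isPos_snoc.1 this
      rw [ha] at ha'
      cases ha'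
      exact ⟨h1, by omega⟩
  | dropPeb i x =>
    refine wp_pure ⟨rfl, ?_⟩
    rw [decide_eq_true_iff, hD x]
    constructor
    · intro h
      exact ⟨hs, _, ⟨rfl, rfl, fun w hw => h ⟨w, hw⟩⟩, by simp⟩
    · rintro ⟨hs1, π1, ⟨-, -, h⟩, -⟩ ⟨w, hw⟩
      exact h w hw
  | retrieve x =>
    refine wp_pure ⟨rfl, iff_of_false (by simp) ?_⟩
    rintro ⟨hs1, π1, ⟨-, w, rfl⟩, h⟩
    simp at h
  | test b τ =>
    refine wp_bind (wp_test (wp_pure ⟨rfl, ?_⟩))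
    have e : testHolds t (liftT N τ) hs σ ↔ testHolds t τ hs π := liftT_holds h τ hs
    simp only [e]
    have : (decide (testHolds t τ hs π) == b) = true ↔ (testHolds t τ hs π ↔ b = true) := by
      by_cases hh : testHolds t τ hs π <;> cases b <;> simp [hh]
    rw [this]
    constructor
    · intro h; exact ⟨hs, π, ⟨rfl, rfl, h⟩, le_rfl⟩
    · rintro ⟨hs1, π1, ⟨-, -, h⟩, -⟩; exact h

abbrev Sub (A : TWA Sig rank k) (N : ℕ) : Type 1 :=
  Set A.X → A.Q → Frag Sig k (PX A N) (Option A.Q)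

open Classical in
noncomputable def popWith (x : A.X) (r : Option A.Q) : Option A.Q :=
  match r with
  | none => none
  | some q2 => if h : ∃ q3, (q2, TInstr.retrieve x, q3) ∈ A.instr then some h.choose else none

noncomputable def execF (sub : Option (Sub A N)) (D : Set A.X) (q1 : A.Q) :
    TInstr Sig k A.X → Frag Sig k (PX A N) (Option A.Q)
  | .up i => fbind (fact (.up i)) fun _ => fpure (some q1)
  | .down i j => fbind (fact (.down i j)) fun _ => fpure (some q1)
  | .dropPeb i x => match sub with
      | none => fpure none
      | some ev => fbind (fact (.dropPeb i (.inl x))) fun _ => fbind (ev (insert x D) q1) fun r =>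
          fbind (fact (.retrieve (.inl x))) fun _ => fpure (popWith x r)
  | .retrieve _ => fpure none
  | .test _ _ => fpure (some q1)

/-- `ev` evaluates maximal coarse runs of level `n`. -/
def EvSpec (t : RTree Sig rank) (n : ℕ) (ev : Sub A N) : Prop :=
  ∀ (D : Set A.X) (σ : List (PX A N × Pos t)) (π : List (A.X × Pos t)), Rel (n + 1) σ π → DS D π →
    ∀ (q : A.Q) (hs : Fin k → Pos t), wp t (ev D q) (hs, σ) (fun o m' => ∃ hs', m' = (hs', σ) ∧
      ((∃ q', o = some q' ∧ Relation.ReflTransGen (MStep A t n π) (q, hs) (q', hs') ∧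
          ∀ c, ¬ MStep A t n π (q', hs') c) ∨
       (o = none ∧ ¬ ∃ h, Relation.ReflTransGen (MStep A t n π) (q, hs) h ∧
          ∀ c, ¬ MStep A t n π h c)))

def SubSpec (t : RTree Sig rank) : ℕ → Option (Sub A N) → Prop
  | 0, s => s = none
  | n + 1, s => ∃ ev, s = some ev ∧ EvSpec t n ev

theorem wp_execF (hA : Deterministic A) {n : ℕ} {sub : Option (Sub A N)}
    (hsub : SubSpec t n sub) {σ : List (PX A N × Pos t)} {π : List (A.X × Pos t)}
    (h : Rel n σ π) {D : Set A.X} (hD : DS D π) (q q1 : A.Q) (ins : TInstr Sig k A.X)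
    (hm : (q, ins, q1) ∈ A.instr) (hs : Fin k → Pos t) (hen : En ins hs π) :
    wp t (execF sub D q1 ins) (hs, σ) (fun o m' => ∃ hs', m' = (hs', σ) ∧
      ((∃ q', o = some q' ∧ MStep A t n π (q, hs) (q', hs')) ∨
       (o = none ∧ ∀ c, ¬ MStep A t n π (q, hs) c))) := by
  obtain ⟨hs1, π1, hi, hlen⟩ := hen
  cases ins with
  | up i =>
    obtain ⟨rfl, hi2⟩ := hi
    refine wp_bind (wp_act (m' := (hs1, σ)) ⟨rfl, hi2⟩ (wp_pure ⟨hs1, rfl, .inl ⟨q1, rfl, ?_⟩⟩))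
    exact MStep_of_step ⟨_, hm, rfl, hi2⟩
  | down i j =>
    obtain ⟨rfl, hi2⟩ := hi
    refine wp_bind (wp_act (m' := (hs1, σ)) ⟨rfl, hi2⟩ (wp_pure ⟨hs1, rfl, .inl ⟨q1, rfl, ?_⟩⟩))
    exact MStep_of_step ⟨_, hm, rfl, hi2⟩
  | retrieve x =>
    obtain ⟨-, w, rfl⟩ := hi
    simp at hlen
  | test b τ =>
    obtain ⟨rfl, rfl, hi2⟩ := hi
    refine wp_pure ⟨_, rfl, .inl ⟨q1, rfl, ?_⟩⟩
    exact MStep_of_step ⟨_, hm, rfl, rfl, hi2⟩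
  | dropPeb i x =>
    obtain ⟨rfl, rfl, hfr⟩ := hi
    have hstep : Step A t (cf (q, hs1) π) (cf (q1, hs1) ((x, hs1 i) :: π)) :=
      ⟨_, hm, rfl, rfl, hfr⟩
    have hno : ∀ c, ¬ Step A t (cf (q, hs1) π) (cf c π) := by
      intro c hc
      have := step_det hA _ _ _ hstep hc
      have := congrArg (fun c : TConf A t => c.2.2.length) this
      simp at this
    cases n with
    | zero =>
      have : sub = none := hsub
      subst this
      exact wp_pure ⟨_, rfl, .inr ⟨rfl, hno⟩⟩
    | succ n =>
      obtain ⟨ev, rfl, hev⟩ := hsub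
      have hRel : Rel (n + 1) ((Sum.inl x, hs1 i) :: σ) ((x, hs1 i) :: π) := by
        refine ⟨fun y w => ?_, fun n' hn' j i' w hw => ?_⟩
        · simp only [List.mem_cons, Prod.mk.injEq, Sum.inl.injEq, h.1]
        · rcases List.mem_cons.1 hw with h' | h'
          · have := congrArg Prod.fst h'
            simp [mkP] at this
          · exact h.2 n' hn' j i' w h'
      have hDS : DS (insert x D) ((x, hs1 i) :: π) := by
        intro y
        rw [Set.mem_insert_iff, hD y]
        simp only [List.mem_cons, Prod.mk.injEq]
        constructor
        · rintro (rfl | ⟨w, hw⟩)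
          · exact ⟨_, .inl ⟨rfl, rfl⟩⟩
          · exact ⟨w, .inr hw⟩
        · rintro ⟨w, ⟨rfl, -⟩ | hw⟩
          · exact .inl rfl
          · exact .inr ⟨w, hw⟩
      refine wp_bind (wp_act (m' := (hs1, (Sum.inl x, hs1 i) :: σ)) ⟨rfl, rfl, ?_⟩ ?_)
      · intro w hw
        exact hfr w ((h.1 x w).1 hw)
      refine wp_seq (hev _ _ _ hRel hDS q1 hs1) ?_
      -- the shape of coarse steps from here
      have hshape : ∀ c, MStep A t (n + 1) π (q, hs1) c → ∃ c2,
          Relation.ReflTransGen (MStep A t n ((x, hs1 i) :: π)) (q1, hs1) c2 ∧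
          (∀ d, ¬ MStep A t n ((x, hs1 i) :: π) c2 d) ∧
          (c2.1, TInstr.retrieve x, c.1) ∈ A.instr := by
        rintro c (hc | ⟨c1, c2, x', w', h1, h2, h3⟩)
        · exact absurd hc (hno c)
        · have e := step_det hA _ _ _ hstep h1
          have e1 : (q1, hs1) = c1 := congrArg (fun c : TConf A t => (c.1, c.2.1)) e
          have e2 : (x, hs1 i) :: π = (x', w') :: π := congrArg (fun c : TConf A t => c.2.2) e
          cases e2
          subst e1
          refine ⟨c2, h2, fun d => pop_term hA h3 d, ?_⟩
          obtain ⟨ins, hm', hi'⟩ := h3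
          have bad : ∀ y : A.X × Pos t, π ≠ y :: π := by
            intro y hy; have := congrArg List.length hy; simp at this
          cases ins with
          | up _ => exact absurd hi'.1 (bad _)
          | down _ _ => exact absurd hi'.1 (bad _)
          | test _ _ => exact absurd hi'.2.1 (bad _)
          | dropPeb _ _ =>
            have := congrArg List.length hi'.2.1
            simp at this
            omega
          | retrieve y =>
            obtain ⟨-, w, hw⟩ := hi'
            simp only [List.cons.injEq, Prod.mk.injEq] at hw
            rw [hw.1.1]; exact hm'
      rintro r _ ⟨hs', rfl, hr⟩
      refine wp_bind (wp_act (m' := (hs', σ)) ⟨rfl, _, rfl⟩ (wp_pure ⟨hs', rfl, ?_⟩))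
      rcases hr with ⟨q2, rfl, hr1, hr2⟩ | ⟨rfl, hr⟩
      · simp only [popWith]
        split_ifs with hex
        · refine .inl ⟨_, rfl, .inr ⟨(q1, hs1), (q2, hs'), x, hs1 i, hstep, hr1, ?_⟩⟩
          exact ⟨_, hex.choose_spec, rfl, _, rfl⟩
        · refine .inr ⟨rfl, fun c hc => ?_⟩
          obtain ⟨c2, h1, h2, h3⟩ := hshape c hc
          have := term_unique (MStep_det hA n _) hr1 hr2 h1 h2
          subst this
          exact hex ⟨_, h3⟩
      · refine .inr ⟨rfl, fun c hc => ?_⟩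
        obtain ⟨c2, h1, h2, h3⟩ := hshape c hc
        exact hr ⟨c2, h1, h2⟩

noncomputable def applyL (sub : Option (Sub A N)) (D : Set A.X) :
    List (TInstr Sig k A.X × A.Q) → Frag Sig k (PX A N) (Option A.Q)
  | [] => fpure none
  | x :: l => fbind (enabled A N D x.1) fun b => if b then execF sub D x.2 x.1 else applyL sub D l

theorem instrAt_fin (A : TWA Sig rank k) (q : A.Q) :
    {x : TInstr Sig k A.X × A.Q | (q, x) ∈ A.instr}.Finite :=
  A.instrFin.preimage ((Prod.mk_right_injective q).injOn)

noncomputable def instrAt (A : TWA Sig rank k) (q : A.Q) : List (TInstr Sig k A.X × A.Q) :=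
  (instrAt_fin A q).toFinset.toList

theorem mem_instrAt (q : A.Q) (x : TInstr Sig k A.X × A.Q) :
    x ∈ instrAt A q ↔ (q, x) ∈ A.instr := by
  simp [instrAt]

noncomputable def applyF (sub : Option (Sub A N)) (D : Set A.X) (q : A.Q) :
    Frag Sig k (PX A N) (Option A.Q) := applyL sub D (instrAt A q)

theorem wp_applyL (hA : Deterministic A) {n : ℕ} {sub : Option (Sub A N)}
    (hsub : SubSpec t n sub) {σ : List (PX A N × Pos t)} {π : List (A.X × Pos t)}
    (h : Rel n σ π) {D : Set A.X} (hD : DS D π) (q : A.Q) (hs : Fin k → Pos t)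
    (l : List (TInstr Sig k A.X × A.Q)) (hl : ∀ x ∈ l, (q, x) ∈ A.instr)
    (hl2 : ∀ x, (q, x) ∈ A.instr → x ∉ l → ¬ En x.1 hs π) :
    wp t (applyL sub D l) (hs, σ) (fun o m' => ∃ hs', m' = (hs', σ) ∧
      ((∃ q', o = some q' ∧ MStep A t n π (q, hs) (q', hs')) ∨
       (o = none ∧ ∀ c, ¬ MStep A t n π (q, hs) c))) := by
  induction l with
  | nil =>
    refine wp_pure ⟨hs, rfl, .inr ⟨rfl, fun c hc => ?_⟩⟩
    obtain ⟨d, ρ, ⟨ins, hm, hi⟩, hlen⟩ := MStep_first hc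
    exact hl2 (ins, d.1) hm (by simp) ⟨_, _, hi, hlen⟩
  | cons x l ih =>
    refine wp_seq (wp_enabled h hD x.1 hs) ?_
    rintro b _ ⟨rfl, hb⟩
    cases b with
    | true => exact wp_execF hA hsub h hD q x.2 x.1 (hl x (by simp)) hs (hb.1 rfl)
    | false =>
      refine ih (fun y hy => hl y (by simp [hy])) fun y hy hyl hen => ?_
      by_cases hxy : y = x
      · subst hxy
        have := hb.2 hen
        simp at this
      · exact hl2 y hy (by simp [hxy, hyl]) hen

theorem ApOK_applyF (hA : Deterministic A) {n : ℕ} {sub : Option (Sub A N)}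
    (hsub : SubSpec t n sub) {σ : List (PX A N × Pos t)} {π : List (A.X × Pos t)}
    (h : Rel n σ π) {D : Set A.X} (hD : DS D π) :
    ApOK (MStep A t n π) (applyF sub D) σ := by
  intro q hs
  exact wp_applyL hA hsub h hD q hs _ (fun x hx => (mem_instrAt q x).1 hx)
    (fun x hx hn => absurd ((mem_instrAt q x).2 hx) hn)

variable {M : ℕ} (e : A.Q ≃ Fin (M + 1))

noncomputable def Ev (N : ℕ) : ℕ → Sub A N
  | 0 => fun D q => evalF rank e (mkP A N 0) (applyF none D) q
  | n + 1 => fun D q => evalF rank e (mkP A N (n + 1)) (applyF (some (Ev N n)) D) q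

theorem evSpec_evalF (hA : Deterministic A) {n : ℕ} (hn : n ≤ N) {sub : Option (Sub A N)}
    (hsub : SubSpec t n sub) :
    EvSpec t n (fun D q => evalF rank e (mkP A N n) (applyF sub D) q) := by
  intro D σ π hRel hD q hs
  refine wp_evalF (mkP_inj2 n) (MStep_det hA n π) ?_ (fun j i w => hRel.2 n (by omega) j i w) q hs
  intro σ' hE
  refine ApOK_applyF hA hsub ⟨fun x w => ?_, fun n' hn' j i w => ?_⟩ hD
  · rw [hE _ _ (fun j i h => by simp [mkP] at h)]
    exact hRel.1 x w
  · rw [hE _ _ (fun j' i' h => by have := mkP_level (by omega) hn h; omega)]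
    exact hRel.2 n' (by omega) j i w

theorem evSpec_Ev (hA : Deterministic A) (n : ℕ) (hn : n ≤ N) : EvSpec t n (Ev e N n) := by
  induction n with
  | zero => exact evSpec_evalF e hA hn rfl
  | succ n ih => exact evSpec_evalF e hA hn ⟨_, rfl, ih (by omega)⟩

open Classical in
noncomputable def mainF (N : ℕ) : Frag Sig k (PX A N) Bool :=
  fbind (Ev e N N ∅ A.q0) fun r => match r with
    | none => fpure false
    | some q => if q ∈ A.acc ∧ ∀ i x q', (q, TInstr.dropPeb i x, q') ∉ A.instr then
        allTest ((List.finRange k).map fun i => .chno i 0) else fpure false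

open Classical in
theorem wp_mainF (hA : Deterministic A) (hN : Nat.card A.X ≤ N) (t : RTree Sig rank) :
    wp t (mainF e N) (fun _ => rootPos t, []) (fun b m => (b = true ↔ Accepts A t) ∧
      (b = true → m = (fun _ => rootPos t, []))) := by
  have hRel : Rel (A := A) (N := N) (t := t) (N + 1) [] [] := ⟨by simp, by simp⟩
  have hDS : DS (A := A) (t := t) ∅ [] := fun x => by simp
  refine wp_seq (evSpec_Ev e hA N le_rfl ∅ [] [] hRel hDS A.q0 (fun _ => rootPos t)) ?_
  rw [accepts_iff hN]
  rintro r _ ⟨hs', rfl, ⟨q, rfl, h1, h2⟩ | ⟨rfl, h⟩⟩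
  · have huniq : ∀ c : Cf A t, Relation.ReflTransGen (MStep A t N []) (A.q0, fun _ => rootPos t) c →
        (∀ d, ¬ MStep A t N [] c d) → c = (q, hs') := fun c hc hc' =>
      term_unique (MStep_det hA N _) hc hc' h1 h2
    show wp t (if q ∈ A.acc ∧ ∀ i x q', (q, TInstr.dropPeb i x, q') ∉ A.instr then
        allTest ((List.finRange k).map fun i => .chno i 0) else fpure false) _ _
    split_ifs with hq
    · refine wp_atRoots ?_
      rw [decide_eq_true_iff]
      refine ⟨⟨fun h => ⟨(q, hs'), h1, h2, hq.1, hq.2, h⟩, ?_⟩, fun h => by rw [h]⟩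
      rintro ⟨c, hc1, hc2, hc3, hc4, hc5⟩
      have := huniq c hc1 hc2
      subst this
      exact hc5
    · refine wp_pure ⟨iff_of_false (by simp) ?_, by simp⟩
      rintro ⟨c, hc1, hc2, hc3, hc4, hc5⟩
      have := huniq c hc1 hc2
      subst this
      exact hq ⟨hc3, hc4⟩
  · refine wp_pure ⟨iff_of_false (by simp) ?_, by simp⟩
    rintro ⟨c, hc1, hc2, -⟩
    exact h ⟨c, hc1, hc2⟩

end Assembly
end NestedPebbles

namespace NestedPebbles

/-- Every deterministic `k`-head tree-walking automaton with
nested pebbles has an equivalent one that halts on every input tree. -/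
theorem always_halting_normal_form (Sig : Type) [Fintype Sig] (rank : Sig → ℕ)
    (k : ℕ) (hk : 1 ≤ k) (A : TWA Sig rank k) (hA : Deterministic A) :
    ∃ A' : TWA Sig rank k, Deterministic A' ∧ Lang A' = Lang A ∧
      ∀ t : RTree Sig rank, ∃ c : TConf A' t,
        Relation.ReflTransGen (Step A' t) (initConf A' t) c ∧
        HaltingConf A' t c := by
  have : NeZero k := ⟨by omega⟩
  obtain ⟨M, ⟨e⟩⟩ : ∃ M, Nonempty (A.Q ≃ Fin (M + 1)) := by
    have := A.finQ
    have hpos : 0 < Fintype.card A.Q := Fintype.card_pos_iff.2 ⟨A.q0⟩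
    obtain ⟨M, hM⟩ := Nat.exists_eq_succ_of_ne_zero hpos.ne'
    exact ⟨M, ⟨Fintype.equivFinOfCardEq hM⟩⟩
  have key := fun t : RTree Sig rank =>
    toTWA_accepts (mainF e (Nat.card A.X)) t (Accepts A t) (wp_mainF e hA le_rfl t)
  refine ⟨toTWA rank (mainF e (Nat.card A.X)), toTWA_det _, ?_, fun t => (key t).2⟩
  ext t
  exact (key t).1

end NestedPebbles
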